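/- arXiv:2405.02872 — 10 statements merged into one kernel-verified Lean document; each statement's English description precedes it below -/
import Mathlib

section
/- There exists a constant C > 0 with the following property: for every real Hilbert space H, every bounded selfadjoint coercive operator A on H, every τ > 0, every N ≥ 7, every choice of f⁶,…,f^N ∈ H and starting values u⁰,…,u⁶ ∈ H, the WSBDF7 approximations u⁷,…,u^N satisfy |uⁿ|² + τ‖uⁿ‖² ≤ C Σ_{j=0}^{6} (|u^j|² + τ‖u^j‖²) + C τ Σ_{ℓ=6}^{n} ‖f^ℓ‖_⋆² for all n = 7,…,N. (First stability estimate for the WSBDF7 method with weight θ = 3.) -/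
open scoped RealInnerProductSpace

/-- Coefficients `α₀,…,α₇` of the WSBDF7 characteristic polynomial
`α(ζ) = (1/420)(3147ζ⁷ − 10038ζ⁶ + 15750ζ⁵ − 16800ζ⁴ + 12425ζ³ − 5922ζ² + 1638ζ − 200)`. -/
noncomputable def alphaCoeff : Fin 8 → ℝ :=
  ![-200 / 420, 1638 / 420, -5922 / 420, 12425 / 420,
    -16800 / 420, 15750 / 420, -10038 / 420, 3147 / 420]


/-- The value `∑ i j, M i j * b (v i) (v j)` of the quadratic form with coefficient matrix `M`
on a tuple of vectors paired by the bilinear form `b`. -/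
def gramForm {H : Type*} [AddCommGroup H] [Module ℝ H] {n : ℕ} (M : Matrix (Fin n) (Fin n) ℝ)
    (b : LinearMap.BilinForm ℝ H) (v : Fin n → H) : ℝ :=
  ∑ i, ∑ j, M i j * b (v i) (v j)

section Gram

variable {H : Type*} [AddCommGroup H] [Module ℝ H] {b : LinearMap.BilinForm ℝ H}

open scoped MatrixOrder in
/-- The Gram matrix of a tuple with respect to a positive semidefinite symmetric bilinear form is
a sum of rank-one Gram matrices of real tuples. -/
lemma exists_real_gram {n : ℕ} (hsymm : ∀ v w, b v w = b w v) (hpos : ∀ v, 0 ≤ b v v)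
    (v : Fin n → H) :
    ∃ X : Fin n → Fin n → ℝ, ∀ i j, b (v i) (v j) = ∑ k, X k i * X k j := by
  have hP : (Matrix.of fun i j => b (v i) (v j)).PosSemidef := by
    refine .of_dotProduct_mulVec_nonneg (by ext i j; simp [hsymm (v i) (v j)]) fun x => ?_
    have := hpos (∑ i, x i • v i)
    simpa [dotProduct, Matrix.mulVec, Finset.mul_sum, mul_left_comm, mul_comm, mul_assoc,
      hsymm] using this
  obtain ⟨X, hX⟩ := CStarAlgebra.nonneg_iff_eq_star_mul_self.mp hP.nonneg
  refine ⟨X, fun i j => ?_⟩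
  have := congrFun (congrFun hX i) j
  simpa [Matrix.mul_apply, Matrix.star_apply] using this

variable {n : ℕ} {v : Fin n → H} {X : Fin n → Fin n → ℝ}

lemma gramForm_comp_eq_sum {m : ℕ} (hX : ∀ i j, b (v i) (v j) = ∑ k, X k i * X k j)
    (M : Matrix (Fin m) (Fin m) ℝ) (e : Fin m → Fin n) :
    gramForm M b (fun i => v (e i)) =
      ∑ k, gramForm M (LinearMap.mul ℝ ℝ) (fun i => X k (e i)) := by
  simp only [gramForm, hX, Finset.mul_sum, LinearMap.mul_apply']
  symm
  rw [Finset.sum_comm]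
  exact Finset.sum_congr rfl fun i _ => Finset.sum_comm

lemma bilin_sum_smul_eq_sum (hX : ∀ i j, b (v i) (v j) = ∑ k, X k i * X k j)
    (a c : Fin n → ℝ) :
    b (∑ i, a i • v i) (∑ j, c j • v j) = ∑ k, (∑ i, a i * X k i) * ∑ j, c j * X k j := by
  simp only [map_sum, map_smul, LinearMap.sum_apply, LinearMap.smul_apply, smul_eq_mul, hX,
    Finset.mul_sum]
  refine (Finset.sum_congr rfl fun i _ => Finset.sum_comm).trans (Finset.sum_comm.trans ?_)
  refine Finset.sum_congr rfl fun k _ => Finset.sum_congr rfl fun j _ => ?_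
  rw [Finset.sum_mul]
  exact Finset.sum_congr rfl fun i _ => by ring

lemma gramForm_le (hsymm : ∀ v w, b v w = b w v) (hpos : ∀ v, 0 ≤ b v v)
    (M : Matrix (Fin n) (Fin n) ℝ) (v : Fin n → H) :
    gramForm M b v ≤ (∑ i, ∑ j, |M i j|) * ∑ k, b (v k) (v k) := by
  simp only [gramForm, Finset.sum_mul]
  refine Finset.sum_le_sum fun i _ => Finset.sum_le_sum fun j _ => ?_
  have hi := Finset.single_le_sum (f := fun k => b (v k) (v k)) (fun k _ => hpos _)
    (Finset.mem_univ i)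
  have hj := Finset.single_le_sum (f := fun k => b (v k) (v k)) (fun k _ => hpos _)
    (Finset.mem_univ j)
  have h1 := hpos (v i - v j)
  have h2 := hpos (v i + v j)
  simp only [map_sub, map_add, LinearMap.sub_apply, LinearMap.add_apply, hsymm (v j) (v i)]
    at h1 h2 hi hj
  refine (le_abs_self _).trans ?_
  rw [abs_mul]
  refine mul_le_mul_of_nonneg_left (abs_le.2 ⟨?_, ?_⟩) (abs_nonneg _) <;> linarith

end Gram

/-- Coefficients of the multiplier `10ζ⁷ - 19ζ⁶ + 18ζ⁵ - 11ζ⁴ + 3ζ³`. -/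
def multiplierCoeff : Fin 8 → ℝ := ![0, 0, 0, 3, -11, 18, -19, 10]

/-- Coefficients of the multiplier divided by `ζ³`. -/
def reducedMultiplierCoeff : Fin 5 → ℝ := ![3, -11, 18, -19, 10]

/-- Coefficients of `3ζ⁷ - 2ζ⁶` divided by `ζ³`. -/
def reducedBetaCoeff : Fin 5 → ℝ := ![0, 0, 0, -2, 3]

/-- Matrix of the `G`-stability norm of `α` relative to the multiplier. -/
def alphaNormMatrix : Matrix (Fin 7) (Fin 7) ℝ :=
  !![371, -2651, 8132, -13810, 14049, -9254, 3563;
     -2651, 19705, -62146, 108114, -112743, 75455, -28610;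
     8132, -62146, 202939, -364781, 393418, -270199, 101605;
     -13810, 108114, -364781, 678062, -757797, 535758, -201428;
     14049, -112743, 393418, -757797, 881807, -647411, 246395;
     -9254, 75455, -270199, 535758, -647411, 497856, -195987;
     3563, -28610, 101605, -201428, 246395, -195987, 80756]

/-- Matrix of the `G`-stability norm of `3ζ⁷ - 2ζ⁶` relative to the multiplier. -/
def betaNormMatrix : Matrix (Fin 4) (Fin 4) ℝ :=
  !![453, -1377, 1461, -672;
     -1377, 4685, -5863, 3080;
     1461, -5863, 9504, -6060;
     -672, 3080, -6060, 4595]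

lemma alphaNorm_increment_le_real (x : Fin 8 → ℝ) :
    gramForm alphaNormMatrix (LinearMap.mul ℝ ℝ) (fun i => x i.succ)
        - gramForm alphaNormMatrix (LinearMap.mul ℝ ℝ) (fun i => x i.castSucc)
      ≤ 1680 * ((∑ i, alphaCoeff i * x i) * ∑ j, multiplierCoeff j * x j) := by
  simp [gramForm, Fin.sum_univ_succ, alphaNormMatrix, alphaCoeff, multiplierCoeff]
  linear_combination
    sq_nonneg (-19 * x 0 + 139 * x 1 - 428 * x 2 + 790 * x 3 - 971 * x 4 + 866 * x 5
      - 587 * x 6 + 210 * x 7) +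
    795 * sq_nonneg (-x 6 + x 7) +
    65 * sq_nonneg (x 5 - 2 * x 6 + x 7) +
    28 * sq_nonneg (x 4 - x 5 - x 6 + x 7) +
    76 * sq_nonneg (-x 3 + x 4 - x 6 + x 7) +
    47 * sq_nonneg (x 2 - x 3 - x 6 + x 7) +
    3 * sq_nonneg (-x 1 + x 2 - x 6 + x 7) +
    10 * sq_nonneg (-x 0 + x 1 - x 6 + x 7)

lemma betaNorm_increment_le_real (x : Fin 5 → ℝ) :
    gramForm betaNormMatrix (LinearMap.mul ℝ ℝ) (fun i => x i.succ)
        - gramForm betaNormMatrix (LinearMap.mul ℝ ℝ) (fun i => x i.castSucc)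
      ≤ 250 * ((∑ i, reducedBetaCoeff i * x i) * ∑ j, reducedMultiplierCoeff j * x j)
        - (∑ i, reducedMultiplierCoeff i * x i) * ∑ j, reducedMultiplierCoeff j * x j := by
  simp [gramForm, Fin.sum_univ_succ, betaNormMatrix, reducedBetaCoeff, reducedMultiplierCoeff]
  linear_combination
    sq_nonneg (21 * x 0 - 64 * x 1 + 67 * x 2 - 65 * x 3 + 52 * x 4) +
    72 * sq_nonneg (x 4) +
    5 * sq_nonneg (x 3 + x 4) +
    6 * sq_nonneg (x 2 + x 4) +
    15 * sq_nonneg (-x 1 + x 4) +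
    3 * sq_nonneg (x 0 + x 4)

lemma alphaNorm_ge_last_real (x : Fin 7 → ℝ) :
    191 * (x 6 * x 6) ≤ gramForm alphaNormMatrix (LinearMap.mul ℝ ℝ) x := by
  simp [gramForm, Fin.sum_univ_succ, alphaNormMatrix]
  linear_combination
    (1 / 371) * sq_nonneg (371 * x 0 - 2651 * x 1 + 8132 * x 2 - 13810 * x 3 + 14049 * x 4
      - 9254 * x 5 + 3563 * x 6) +
    (1 / 104901734) * sq_nonneg (282754 * x 1 - 1498234 * x 2 + 3499984 * x 3 - 4583754 * x 4
      + 3461451 * x 5 - 1168797 * x 6) +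
    (1 / 65846761456869) * sq_nonneg (465752997 * x 2 - 1709251429 * x 3 + 2828906312 * x 4
      - 2533752010 * x 5 + 963349774 * x 6) +
    (1 / 620140240253225057301) * sq_nonneg (1331478797233 * x 3 - 3946759832867 * x 4
      + 4671159004504 * x 5 - 2234225844124 * x 6) +
    (1 / 5064054221872888868589969993) * sq_nonneg (3803330727005721 * x 4
      - 9516199872109548 * x 5 + 6382445432323523 * x 6) +
    (1 / 14444701851999112084439121778597642) * sq_nonneg (5696862653608003303 * x 5
      - 6731231204434108687 * x 6) +
    (85343051844222865 / 17090587960824009909) * sq_nonneg (x 6)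

lemma betaNorm_ge_last_real (x : Fin 4 → ℝ) :
    256 * (x 3 * x 3) ≤ gramForm betaNormMatrix (LinearMap.mul ℝ ℝ) x := by
  simp [gramForm, Fin.sum_univ_succ, betaNormMatrix]
  linear_combination
    (3 / 151) * sq_nonneg (151 * x 0 - 459 * x 1 + 487 * x 2 - 224 * x 3) +
    (1 / 2846048) * sq_nonneg (37696 * x 1 - 107357 * x 2 + 78316 * x 3) +
    (1 / 263726059936) * sq_nonneg (13992257 * x 2 - 17688796 * x 3) +
    (8884931 / 13992257) * sq_nonneg (x 3)

section Lyapunov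

variable {H : Type*} [AddCommGroup H] [Module ℝ H] {b : LinearMap.BilinForm ℝ H}

lemma alphaNorm_increment_le (hsymm : ∀ v w, b v w = b w v) (hpos : ∀ v, 0 ≤ b v v)
    (v : Fin 8 → H) :
    gramForm alphaNormMatrix b (fun i => v i.succ)
        - gramForm alphaNormMatrix b (fun i => v i.castSucc)
      ≤ 1680 * b (∑ i, alphaCoeff i • v i) (∑ j, multiplierCoeff j • v j) := by
  obtain ⟨X, hX⟩ := exists_real_gram hsymm hpos v
  rw [gramForm_comp_eq_sum hX, gramForm_comp_eq_sum hX, bilin_sum_smul_eq_sum hX,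
    Finset.mul_sum, ← Finset.sum_sub_distrib]
  exact Finset.sum_le_sum fun k _ => alphaNorm_increment_le_real (X k)

lemma betaNorm_increment_le (hsymm : ∀ v w, b v w = b w v) (hpos : ∀ v, 0 ≤ b v v)
    (v : Fin 5 → H) :
    gramForm betaNormMatrix b (fun i => v i.succ)
        - gramForm betaNormMatrix b (fun i => v i.castSucc)
      ≤ 250 * b (∑ i, reducedBetaCoeff i • v i) (∑ j, reducedMultiplierCoeff j • v j)
        - b (∑ i, reducedMultiplierCoeff i • v i) (∑ j, reducedMultiplierCoeff j • v j) := by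
  obtain ⟨X, hX⟩ := exists_real_gram hsymm hpos v
  rw [gramForm_comp_eq_sum hX, gramForm_comp_eq_sum hX, bilin_sum_smul_eq_sum hX,
    bilin_sum_smul_eq_sum hX, Finset.mul_sum, ← Finset.sum_sub_distrib, ← Finset.sum_sub_distrib]
  exact Finset.sum_le_sum fun k _ => betaNorm_increment_le_real (X k)

lemma alphaNorm_ge_last (hsymm : ∀ v w, b v w = b w v) (hpos : ∀ v, 0 ≤ b v v)
    (v : Fin 7 → H) : 191 * b (v 6) (v 6) ≤ gramForm alphaNormMatrix b v := by
  obtain ⟨X, hX⟩ := exists_real_gram hsymm hpos v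
  have := gramForm_comp_eq_sum hX alphaNormMatrix id
  simp only [id] at this
  rw [hX, this, Finset.mul_sum]
  exact Finset.sum_le_sum fun k _ => alphaNorm_ge_last_real (X k)

lemma betaNorm_ge_last (hsymm : ∀ v w, b v w = b w v) (hpos : ∀ v, 0 ≤ b v v)
    (v : Fin 4 → H) : 256 * b (v 3) (v 3) ≤ gramForm betaNormMatrix b v := by
  obtain ⟨X, hX⟩ := exists_real_gram hsymm hpos v
  have := gramForm_comp_eq_sum hX betaNormMatrix id
  simp only [id] at this
  rw [hX, this, Finset.mul_sum]
  exact Finset.sum_le_sum fun k _ => betaNorm_ge_last_real (X k)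

end Lyapunov

/-- Abstract one-step energy estimate: `b₀` is the pivot form, `b₁` the energy form, `g` the
Riesz representative of the load with respect to `b₁`. -/
lemma energy_increment_le {H : Type*} [AddCommGroup H] [Module ℝ H]
    {b₀ b₁ : LinearMap.BilinForm ℝ H} (hsymm₀ : ∀ v w, b₀ v w = b₀ w v) (hpos₀ : ∀ v, 0 ≤ b₀ v v)
    (hsymm₁ : ∀ v w, b₁ v w = b₁ w v) (hpos₁ : ∀ v, 0 ≤ b₁ v v) {τ : ℝ} (hτ : 0 ≤ τ)
    (w : ℕ → H) (p q : H)
    (hw : ∀ z, b₀ (∑ i : Fin 8, alphaCoeff i • w i) z + τ * b₁ ((3 : ℝ) • w 7 - (2 : ℝ) • w 6) z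
      = τ * b₁ ((3 : ℝ) • p - (2 : ℝ) • q) z) :
    gramForm alphaNormMatrix b₀ (fun i => w (i + 1)) / 1680
        + τ * (gramForm betaNormMatrix b₁ (fun i => w (i + 4)) / 250)
      ≤ gramForm alphaNormMatrix b₀ (fun i => w i) / 1680
        + τ * (gramForm betaNormMatrix b₁ (fun i => w (i + 3)) / 250)
        + 1125 * τ * (b₁ p p + b₁ q q) := by
  have hα := alphaNorm_increment_le hsymm₀ hpos₀ (fun i : Fin 8 => w i)
  have hβ := betaNorm_increment_le hsymm₁ hpos₁ (fun i : Fin 5 => w (i + 3))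
  have hm : ∑ j : Fin 8, multiplierCoeff j • w j
      = ∑ j : Fin 5, reducedMultiplierCoeff j • w (j + 3) := by
    simp [Fin.sum_univ_succ, multiplierCoeff, reducedMultiplierCoeff]
  have hb : ∑ j : Fin 5, reducedBetaCoeff j • w (j + 3) = (3 : ℝ) • w 7 - (2 : ℝ) • w 6 := by
    simp [Fin.sum_univ_succ, reducedBetaCoeff]
    module
  rw [hm] at hα
  rw [hb] at hβ
  simp only [Fin.val_succ, Fin.val_castSucc, add_assoc, Nat.reduceAdd] at hα hβ
  set m := ∑ j : Fin 5, reducedMultiplierCoeff j • w (j + 3)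
  have hwm := hw m
  have hload : b₁ ((3 : ℝ) • p - (2 : ℝ) • q) m - b₁ m m / 250
      ≤ 1125 * (b₁ p p + b₁ q q) := by
    have h1 := hpos₁ (((3 : ℝ) • p - (2 : ℝ) • q) - (2 / 250 : ℝ) • m)
    have h2 := hpos₁ (p + q)
    have h3 := hpos₁ p
    have h4 := hpos₁ q
    simp only [map_sub, map_add, map_smul, LinearMap.sub_apply, LinearMap.add_apply,
      LinearMap.smul_apply, smul_eq_mul, hsymm₁ m, hsymm₁ q p] at h1 h2 ⊢
    linarith
  linear_combination hα / 1680 + τ / 250 * hβ + hwm + τ * hload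

/-- First stability estimate for the WSBDF7 method with weight θ = 3. -/
theorem wsbdf7_first_stability :
    ∃ C : ℝ, 0 < C ∧
      ∀ (H : Type) [_i1 : NormedAddCommGroup H] [_i2 : InnerProductSpace ℝ H] [_i3 : CompleteSpace H]
        (A B : H →L[ℝ] H),
        (∀ v w : H, ⟪A v, w⟫ = ⟪v, A w⟫) →
        (∃ lam : ℝ, 0 < lam ∧ ∀ v : H, lam * ‖v‖ ^ 2 ≤ ⟪A v, v⟫) →
        (∀ v : H, A (B v) = v) → (∀ v : H, B (A v) = v) →
        ∀ τ : ℝ, 0 < τ → ∀ N : ℕ, 7 ≤ N →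
        ∀ f u : ℕ → H,
          (∀ n : ℕ, n ≤ N - 7 →
            ∑ i : Fin 8, alphaCoeff i • u (n + i.1) + (3 * τ) • A (u (n + 7))
              - (2 * τ) • A (u (n + 6))
            = (3 * τ) • f (n + 7) - (2 * τ) • f (n + 6)) →
          ∀ n : ℕ, 7 ≤ n → n ≤ N →
            ‖u n‖ ^ 2 + τ * ⟪A (u n), u n⟫
              ≤ C * ∑ j ∈ Finset.range 7, (‖u j‖ ^ 2 + τ * ⟪A (u j), u j⟫)
                + C * τ * ∑ ℓ ∈ Finset.Icc 6 n, ⟪B (f ℓ), f ℓ⟫ := by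
  set cα : ℝ := ∑ i, ∑ j, |alphaNormMatrix i j|
  set cβ : ℝ := ∑ i, ∑ j, |betaNormMatrix i j|
  have hcα : 0 ≤ cα := by positivity
  have hcβ : 0 ≤ cβ := by positivity
  refine ⟨10 * (cα + cβ + 2250), by positivity, ?_⟩
  intro H _ _ _ A B hA hcoer hAB _ τ hτ N _ f u hscheme n hn hnN
  obtain ⟨lam, hlam, hcoer⟩ := hcoer
  set b₀ : LinearMap.BilinForm ℝ H := innerₗ H
  set b₁ : LinearMap.BilinForm ℝ H := innerₗ H ∘ₗ (A : H →ₗ[ℝ] H)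
  have hb₀ : ∀ v w, b₀ v w = ⟪v, w⟫ := fun _ _ => rfl
  have hb₁ : ∀ v w, b₁ v w = ⟪A v, w⟫ := fun _ _ => rfl
  have hsymm₀ : ∀ v w, b₀ v w = b₀ w v := fun v w => real_inner_comm w v
  have hpos₀ : ∀ v, 0 ≤ b₀ v v := fun v => real_inner_self_nonneg
  have hsymm₁ : ∀ v w, b₁ v w = b₁ w v := fun v w => by
    rw [hb₁, hb₁, hA, real_inner_comm]
  have hpos₁ : ∀ v, 0 ≤ b₁ v v := fun v => (by positivity : 0 ≤ lam * ‖v‖ ^ 2).trans (hcoer v)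
  have hdual : ∀ g, b₁ (B g) (B g) = ⟪B g, g⟫ := fun g => by
    rw [hb₁, hAB, real_inner_comm]
  set E : ℕ → ℝ := fun k => gramForm alphaNormMatrix b₀ (fun i => u (k + i)) / 1680
    + τ * (gramForm betaNormMatrix b₁ (fun i => u (k + (i + 3))) / 250) with hE
  set φ : ℕ → ℝ := fun ℓ => ⟪B (f ℓ), f ℓ⟫
  have hφ0 : ∀ ℓ, 0 ≤ φ ℓ := fun ℓ => (hpos₁ _).trans_eq (hdual _)
  have hstep : ∀ k, k ≤ N - 7 → E (k + 1) ≤ E k + 1125 * τ * (φ (k + 7) + φ (k + 6)) := by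
    intro k hk
    have h := energy_increment_le hsymm₀ hpos₀ hsymm₁ hpos₁ hτ.le (fun i => u (k + i))
      (B (f (k + 7))) (B (f (k + 6))) (fun z => by
        have h := congrArg (fun y => ⟪y, z⟫) (hscheme k hk)
        simp only [inner_add_left, inner_sub_left, real_inner_smul_left] at h
        rw [hb₀, hb₁, hb₁]
        simp only [map_sub, map_smul, hAB, inner_sub_left, real_inner_smul_left]
        linear_combination h)
    rw [hdual, hdual] at h
    simpa only [hE, φ, add_assoc, add_comm, add_left_comm, Nat.reduceAdd] using h
  have hbound : ∀ k, k ≤ N - 6 →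
      E k ≤ E 0 + 1125 * τ * (2 * ∑ ℓ ∈ Finset.Icc 6 (k + 6), φ ℓ - φ (k + 6)) := by
    intro k
    induction k with
    | zero => intro _; simp; nlinarith [mul_nonneg hτ.le (hφ0 6)]
    | succ k ih =>
      intro hk
      have h1 := ih (by omega)
      have h2 := hstep k (by omega)
      have h3 : ∑ ℓ ∈ Finset.Icc 6 (k + 1 + 6), φ ℓ
          = ∑ ℓ ∈ Finset.Icc 6 (k + 6), φ ℓ + φ (k + 7) := by
        rw [show k + 1 + 6 = (k + 6) + 1 by ring, Finset.sum_Icc_succ_top (by omega)]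
      rw [h3, show k + 1 + 6 = k + 7 by ring]
      have h4 := mul_nonneg hτ.le (hφ0 (k + 6))
      linarith
  have hlast : (b₀ (u n) (u n) + τ * b₁ (u n) (u n)) / 10 ≤ E (n - 6) := by
    have h1 := alphaNorm_ge_last hsymm₀ hpos₀ (fun i : Fin 7 => u (n - 6 + i))
    have h2 := betaNorm_ge_last hsymm₁ hpos₁ (fun i : Fin 4 => u (n - 6 + (i + 3)))
    have h3 := hpos₀ (u n)
    have h4 := mul_nonneg hτ.le (hpos₁ (u n))
    have h5 := mul_le_mul_of_nonneg_left h2 hτ.le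
    have e : n - 6 + 6 = n := by omega
    simp only [Fin.isValue, Fin.coe_ofNat_eq_mod, Nat.reduceMod, Nat.reduceAdd, e] at h1 h2 h5
    simp only [hE]
    linarith
  have hinit : E 0 ≤ (cα + cβ) * ∑ j ∈ Finset.range 7, (b₀ (u j) (u j) + τ * b₁ (u j) (u j)) := by
    have h1 := gramForm_le hsymm₀ hpos₀ alphaNormMatrix (fun i => u (0 + i))
    have h2 := gramForm_le hsymm₁ hpos₁ betaNormMatrix (fun i => u (0 + (i + 3)))
    have h3 : ∑ k : Fin 4, b₁ (u (0 + (k + 3))) (u (0 + (k + 3)))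
        ≤ ∑ j ∈ Finset.range 7, b₁ (u j) (u j) := by
      simp only [Fin.sum_univ_four, Finset.sum_range_succ, Finset.sum_range_zero]
      have := hpos₁ (u 0)
      have := hpos₁ (u 1)
      have := hpos₁ (u 2)
      norm_num
      linarith
    have h4 : ∑ k : Fin 7, b₀ (u (0 + k)) (u (0 + k)) = ∑ j ∈ Finset.range 7, b₀ (u j) (u j) := by
      simp only [zero_add, Finset.sum_range]
    rw [h4] at h1
    have hS₀ : 0 ≤ ∑ j ∈ Finset.range 7, b₀ (u j) (u j) := Finset.sum_nonneg fun j _ => hpos₀ _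
    have hS₁ : 0 ≤ ∑ j ∈ Finset.range 7, b₁ (u j) (u j) := Finset.sum_nonneg fun j _ => hpos₁ _
    rw [Finset.sum_add_distrib, ← Finset.mul_sum]
    have h5 := mul_le_mul_of_nonneg_left (h2.trans (mul_le_mul_of_nonneg_left h3 hcβ)) hτ.le
    have h6 := mul_nonneg hcα hS₀
    have h7 := mul_nonneg hcβ hS₀
    have h8 := mul_nonneg hτ.le (mul_nonneg hcα hS₁)
    have h9 := mul_nonneg hτ.le (mul_nonneg hcβ hS₁)
    simp only [hE]
    linarith
  have hk := hbound (n - 6) (by omega)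
  rw [Nat.sub_add_cancel (by omega : 6 ≤ n)] at hk
  have hS : 0 ≤ ∑ j ∈ Finset.range 7, (b₀ (u j) (u j) + τ * b₁ (u j) (u j)) :=
    Finset.sum_nonneg fun j _ => add_nonneg (hpos₀ _) (mul_nonneg hτ.le (hpos₁ _))
  have hΦ : 0 ≤ ∑ ℓ ∈ Finset.Icc 6 n, φ ℓ := Finset.sum_nonneg fun ℓ _ => hφ0 ℓ
  simp only [← real_inner_self_eq_norm_sq, ← hb₁, ← hb₀]
  have hτφ := mul_nonneg hτ.le (hφ0 n)
  have hτΦ := mul_nonneg (add_nonneg hcα hcβ) (mul_nonneg hτ.le hΦ)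
  linarith
end

section
/- There exists a constant C > 0 with the following property: for every real Hilbert space H, every bounded selfadjoint coercive operator A on H, every τ > 0, every N ≥ 7, every choice of f⁶,…,f^N ∈ H and starting values u⁰,…,u⁶ ∈ H, the WSBDF7 approximations satisfy ‖uⁿ‖² + τ|u̇ⁿ|² ≤ C Σ_{j=0}^{6} ‖u^j‖² + C τ Σ_{ℓ=6}^{n} |f^ℓ|² for all n = 7,…,N, where u̇^m := (1/τ) Σ_{i=0}^{7} α_i u^{m−7+i}. (Second stability estimate for the WSBDF7 method with weight θ = 3.) -/
open scoped RealInnerProductSpace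

section Autocorrelation

variable {H : Type*} [AddCommGroup H] [Module ℝ H]

/-- The autocorrelation `∑ₙ B (v n) (v (n + k))` of a sequence supported in `[0, M)`. -/
def autocorr (B : LinearMap.BilinForm ℝ H) (v : ℕ → H) (M k : ℕ) : ℝ :=
  ∑ n ∈ Finset.range M, B (v n) (v (n + k))

theorem sum_range_shift (F : ℕ → ℝ) {M i : ℕ} (hlow : ∀ n < i, F n = 0)
    (hhigh : ∀ n, M ≤ n → F n = 0) :
    ∑ n ∈ Finset.range M, F (n + i) = ∑ n ∈ Finset.range M, F n := by
  have h₁ := Finset.sum_range_add F i M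
  have h₂ := Finset.sum_range_add F M i
  rw [Finset.sum_eq_zero fun n hn => hlow n (Finset.mem_range.1 hn)] at h₁
  rw [Finset.sum_eq_zero (s := Finset.range i) fun n _ => hhigh (M + n) (by lia)] at h₂
  rw [add_comm M i, h₁] at h₂
  simpa [add_comm] using h₂

variable {B : LinearMap.BilinForm ℝ H} {v : ℕ → H} {a M : ℕ}

theorem sum_shift_eq_autocorr (hsymm : ∀ x y, B x y = B y x) (hlow : ∀ n < a, v n = 0)
    (hhigh : ∀ n, M ≤ n → v n = 0) {i j : ℕ} (hi : i ≤ a) (hj : j ≤ a) :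
    ∑ n ∈ Finset.range M, B (v (n + i)) (v (n + j)) = autocorr B v M (i - j + (j - i)) := by
  wlog hij : i ≤ j generalizing i j
  · rw [add_comm (i - j), ← this hj hi (by lia)]
    exact Finset.sum_congr rfl fun n _ => hsymm _ _
  have h := sum_range_shift (fun n => B (v n) (v (n + (j - i)))) (M := M) (i := i)
    (fun n hn => by simp [hlow n (by lia)]) (fun n hn => by simp [hhigh n hn])
  rw [autocorr, Nat.sub_eq_zero_of_le hij, zero_add, ← h]
  exact Finset.sum_congr rfl fun n _ => by
    rw [show n + i + (j - i) = n + j by lia]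

theorem form_sum_smul {D : ℕ} (c : Fin D → ℝ) (x : Fin D → H) :
    B (∑ i, c i • x i) (∑ j, c j • x j) = ∑ i, ∑ j, c i * c j * B (x i) (x j) := by
  simp only [map_sum, LinearMap.sum_apply, map_smul, LinearMap.smul_apply, smul_eq_mul,
    Finset.mul_sum, mul_assoc]
  rw [Finset.sum_comm]
  exact Finset.sum_congr rfl fun i _ => Finset.sum_congr rfl fun j _ => mul_left_comm _ _ _

theorem autocorr_form_nonneg (hsymm : ∀ x y, B x y = B y x) (hpos : ∀ x, 0 ≤ B x x)
    (hlow : ∀ n < a, v n = 0) (hhigh : ∀ n, M ≤ n → v n = 0) {D : ℕ} (hD : D ≤ a + 1)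
    (q : Fin D → ℝ) :
    0 ≤ ∑ i, ∑ j, q i * q j * autocorr B v M (i - j + (j - i)) := by
  have h := Finset.sum_nonneg fun n (_ : n ∈ Finset.range M) => hpos (∑ i, q i • v (n + i))
  simp only [form_sum_smul] at h
  rw [Finset.sum_comm] at h
  refine h.trans_eq (Finset.sum_congr rfl fun i _ => ?_)
  rw [Finset.sum_comm]
  refine Finset.sum_congr rfl fun j _ => ?_
  rw [← Finset.mul_sum, sum_shift_eq_autocorr hsymm hlow hhigh (by lia) (by lia)]

theorem abs_autocorr_le (hsymm : ∀ x y, B x y = B y x) (hpos : ∀ x, 0 ≤ B x x)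
    (hlow : ∀ n < a, v n = 0) (hhigh : ∀ n, M ≤ n → v n = 0) {k : ℕ} (hk : k ≤ a) :
    |autocorr B v M k| ≤ autocorr B v M 0 := by
  have h₁ := sum_shift_eq_autocorr hsymm hlow hhigh hk hk
  have h₂ := sum_shift_eq_autocorr hsymm hlow hhigh hk (Nat.zero_le a)
  have hp := Finset.sum_nonneg fun n (_ : n ∈ Finset.range M) => hpos (v n + v (n + k))
  have hm := Finset.sum_nonneg fun n (_ : n ∈ Finset.range M) => hpos (v n - v (n + k))
  simp only [map_add, map_sub, LinearMap.add_apply, LinearMap.sub_apply, Finset.sum_add_distrib,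
    Finset.sum_sub_distrib, hsymm (v (_ + k)) (v _)] at hp hm
  simp only [Nat.sub_self, Nat.zero_sub, Nat.sub_zero, add_zero, hsymm (v (_ + k)) (v _)] at h₁ h₂
  have h₃ : ∑ n ∈ Finset.range M, B (v n) (v n) = autocorr B v M 0 := rfl
  exact abs_le.2 ⟨by linarith, by linarith⟩

theorem autocorr_diff (hsymm : ∀ x y, B x y = B y x) (hlow : ∀ n < a, v n = 0)
    (hhigh : ∀ n, M ≤ n → v n = 0) {k : ℕ} (hk : k + 1 ≤ a) :
    autocorr B (fun n => v (n + 1) - v n) M k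
      = 2 * autocorr B v M k - autocorr B v M (k + 1) - autocorr B v M (1 - k + (k - 1)) := by
  have h₁ := sum_shift_eq_autocorr hsymm hlow hhigh (show 1 ≤ a by lia) hk
  have h₂ := sum_shift_eq_autocorr hsymm hlow hhigh (show 1 ≤ a by lia) (show k ≤ a by lia)
  have h₃ := sum_shift_eq_autocorr hsymm hlow hhigh (Nat.zero_le a) hk
  have h₄ : ∑ n ∈ Finset.range M, B (v n) (v (n + k)) = autocorr B v M k := rfl
  rw [show 1 - (k + 1) + (k + 1 - 1) = k by lia] at h₁
  have h₃ : ∑ n ∈ Finset.range M, B (v n) (v (n + (k + 1))) = autocorr B v M (k + 1) := rfl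
  have h₄ : ∑ n ∈ Finset.range M, B (v n) (v (n + k)) = autocorr B v M k := rfl
  rw [autocorr]
  simp only [map_sub, LinearMap.sub_apply, Finset.sum_sub_distrib, add_assoc _ k 1, h₁, h₂, h₃, h₄]
  ring

theorem sum_conv_eq_autocorr (hsymm : ∀ x y, B x y = B y x) (hlow : ∀ n < a, v n = 0)
    (hhigh : ∀ n, M ≤ n → v n = 0) {D : ℕ} (hD : D ≤ a + 1) (c : Fin D → ℝ) :
    ∑ n ∈ Finset.range M, B (v n) (∑ k, c k • v (n - k)) = ∑ k, c k * autocorr B v M k := by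
  simp only [map_sum, map_smul, smul_eq_mul]
  rw [Finset.sum_comm]
  refine Finset.sum_congr rfl fun k _ => ?_
  rw [← Finset.mul_sum, autocorr, ← sum_range_shift (fun n => B (v n) (v (n - k))) (i := k)
    (fun n hn => by simp [hlow n (by lia)]) (fun n hn => by simp [hhigh n hn])]
  simp only [Nat.add_sub_cancel, hsymm (v (_ + _))]

theorem form_sum_smul_le (hsymm : ∀ x y, B x y = B y x) (hpos : ∀ x, 0 ≤ B x x)
    {D : ℕ} (c : Fin D → ℝ) (x : Fin D → H) :
    B (∑ i, c i • x i) (∑ i, c i • x i) ≤ (∑ i, c i ^ 2) * ∑ i, B (x i) (x i) := by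
  have h : ∀ i j, c i * c j * B (x i) (x j)
      ≤ (c j ^ 2 * B (x i) (x i) + c i ^ 2 * B (x j) (x j)) / 2 := fun i j => by
    have := hpos (c j • x i - c i • x j)
    simp only [map_sub, LinearMap.sub_apply, map_smul, LinearMap.smul_apply, smul_eq_mul,
      hsymm (x j) (x i)] at this
    linarith
  calc B (∑ i, c i • x i) (∑ i, c i • x i) = ∑ i, ∑ j, c i * c j * B (x i) (x j) :=
        form_sum_smul c x
    _ ≤ ∑ i, ∑ j, (c j ^ 2 * B (x i) (x i) + c i ^ 2 * B (x j) (x j)) / 2 :=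
        Finset.sum_le_sum fun i _ => Finset.sum_le_sum fun j _ => h i j
    _ = (∑ i, c i ^ 2) * ∑ i, B (x i) (x i) := by
        simp only [add_div, Finset.sum_add_distrib]
        rw [Finset.sum_comm, ← two_mul, Finset.sum_mul_sum, Finset.mul_sum]
        refine Finset.sum_congr rfl fun i _ => ?_
        rw [Finset.mul_sum]
        exact Finset.sum_congr rfl fun j _ => by ring

theorem two_mul_form_le (hsymm : ∀ x y, B x y = B y x) (hpos : ∀ x, 0 ≤ B x x) (x y : H) :
    2 * B x y ≤ B x x + B y y := by
  have := hpos (x - y)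
  simp only [map_sub, LinearMap.sub_apply, hsymm y x] at this
  linarith

theorem form_shifted_le (hsymm : ∀ x y, B x y = B y x) (hpos : ∀ x, 0 ≤ B x x) (x y : H) :
    B ((3 : ℝ) • x - (2 : ℝ) • y) ((3 : ℝ) • x - (2 : ℝ) • y) ≤ 18 * B x x + 8 * B y y := by
  have := hpos ((3 : ℝ) • x + (2 : ℝ) • y)
  simp only [map_sub, map_add, map_smul, LinearMap.sub_apply, LinearMap.add_apply,
    LinearMap.smul_apply, smul_eq_mul, hsymm y x] at this ⊢
  linarith

theorem form_le_of_shifted (hsymm : ∀ x y, B x y = B y x) (hpos : ∀ x, 0 ≤ B x x) (x y : H) :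
    B x x ≤ B ((3 : ℝ) • x - (2 : ℝ) • y) ((3 : ℝ) • x - (2 : ℝ) • y) / 3 + 2 / 3 * B y y := by
  have := hpos (x - y)
  simp only [map_sub, map_smul, LinearMap.sub_apply, LinearMap.smul_apply, smul_eq_mul,
    hsymm y x] at this ⊢
  linarith

theorem sum_range_sub_le {g : ℕ → ℝ} (hg : ∀ n, 0 ≤ g n) (hlow : ∀ n < a, g n = 0) {j : ℕ}
    (hj : j ≤ a) (M : ℕ) :
    ∑ n ∈ Finset.range M, g (n - j) ≤ ∑ n ∈ Finset.range M, g n := by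
  have h := Finset.sum_range_add (fun n => g (n - j)) j M
  rw [Finset.sum_eq_zero (s := Finset.range j) fun n hn => hlow (n - j) (by
    have := Finset.mem_range.1 hn
    lia)] at h
  simp only [Nat.add_sub_cancel_left, zero_add] at h
  rw [← h]
  exact Finset.sum_le_sum_of_subset_of_nonneg (Finset.range_mono (by lia)) fun n _ _ => hg _

end Autocorrelation

section Positivity

variable {H : Type*} [AddCommGroup H] [Module ℝ H]

/-- Coefficients of `(50 + 101z + 112z² + 82z³ + 39z⁴ + 16z⁵)(3147 − 10038z + ⋯ − 200z⁷)`. -/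
def energyCoeff : Fin 13 → ℝ :=
  ![157350, -184053, 126126, -115452, -11933, 27595, -48580, 107824, -106573, 79758, -47270,
    18408, -3200]

/-- Coefficients of `(50 + 101z + 112z² + 82z³ + 39z⁴ + 16z⁵)(3 − 2z)`. -/
def dissipCoeff : Fin 7 → ℝ :=
  ![150, 203, 134, 22, -47, -30, -32]

variable {B : LinearMap.BilinForm ℝ H} {v : ℕ → H} {M : ℕ}

theorem dissipCoeff_form_ge (hsymm : ∀ x y, B x y = B y x) (hpos : ∀ x, 0 ≤ B x x)
    (hlow : ∀ n < 12, v n = 0) (hhigh : ∀ n, M ≤ n → v n = 0) :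
    autocorr B v M 0 / 5 ≤ ∑ n ∈ Finset.range M, B (v n) (∑ k, dissipCoeff k • v (n - k)) := by
  rw [sum_conv_eq_autocorr hsymm hlow hhigh (by norm_num)]
  have hq := autocorr_form_nonneg hsymm hpos hlow hhigh (by norm_num)
    ![200, 153, 255, 132, -5, -14, -82]
  have habs := fun k (hk : k ≤ 12) => abs_le.1 (abs_autocorr_le hsymm hpos hlow hhigh hk)
  simp [Fin.sum_univ_succ] at hq
  simp [Fin.sum_univ_succ, dissipCoeff]
  have h₁ := habs 1 (by norm_num)
  have h₂ := habs 2 (by norm_num)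
  have h₃ := habs 3 (by norm_num)
  have h₄ := habs 4 (by norm_num)
  have h₅ := habs 5 (by norm_num)
  have h₆ := habs 6 (by norm_num)
  linarith

theorem energyCoeff_form_ge (hsymm : ∀ x y, B x y = B y x) (hpos : ∀ x, 0 ≤ B x x)
    (hlow : ∀ n < 12, v n = 0) (hhigh : ∀ n, M ≤ n → v n = 0) :
    autocorr B (fun n => v (n + 1) - v n) M 0
      ≤ ∑ n ∈ Finset.range M, B (v n) (∑ k, energyCoeff k • v (n - k)) := by
  rw [sum_conv_eq_autocorr hsymm hlow hhigh (by norm_num)]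
  have elow : ∀ n < 11, v (n + 1) - v n = 0 := fun n hn => by
    rw [hlow n (by lia), hlow (n + 1) (by lia), sub_zero]
  have ehigh : ∀ n, M ≤ n → v (n + 1) - v n = 0 := fun n hn => by
    rw [hhigh n hn, hhigh (n + 1) (by lia), sub_zero]
  have hq := autocorr_form_nonneg hsymm hpos elow ehigh (by norm_num)
    ![97, 11, 43, -54, -40, -47, -3, 25, -29, 26, -16, 4]
  have habs := fun k (hk : k ≤ 11) => abs_le.1 (abs_autocorr_le hsymm hpos elow ehigh hk)
  have hd := fun k (hk : k + 1 ≤ 12) => autocorr_diff hsymm hlow hhigh hk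
  set e := fun n => v (n + 1) - v n
  simp [Fin.sum_univ_succ] at hq
  simp [Fin.sum_univ_succ, energyCoeff]
  have h₁ := habs 1 (by norm_num)
  have h₂ := habs 2 (by norm_num)
  have h₃ := habs 3 (by norm_num)
  have h₄ := habs 4 (by norm_num)
  have h₅ := habs 5 (by norm_num)
  have h₆ := habs 6 (by norm_num)
  have h₇ := habs 7 (by norm_num)
  have h₈ := habs 8 (by norm_num)
  have h₉ := habs 9 (by norm_num)
  have h₁₀ := habs 10 (by norm_num)
  have h₁₁ := habs 11 (by norm_num)
  have d₀ := hd 0 (by norm_num)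
  have d₁ := hd 1 (by norm_num)
  have d₂ := hd 2 (by norm_num)
  have d₃ := hd 3 (by norm_num)
  have d₄ := hd 4 (by norm_num)
  have d₅ := hd 5 (by norm_num)
  have d₆ := hd 6 (by norm_num)
  have d₇ := hd 7 (by norm_num)
  have d₈ := hd 8 (by norm_num)
  have d₉ := hd 9 (by norm_num)
  have d₁₀ := hd 10 (by norm_num)
  have d₁₁ := hd 11 (by norm_num)
  norm_num at d₀ d₁ d₂ d₃ d₄ d₅ d₆ d₇ d₈ d₉ d₁₀ d₁₁
  linarith

theorem form_le_autocorr_diff (hpos : ∀ x, 0 ≤ B x x) {m : ℕ} (hm : v (m + 1) = 0) :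
    B (v m) (v m) ≤ autocorr B (fun n => v (n + 1) - v n) (m + 1) 0 := by
  have h := Finset.single_le_sum (f := fun n => B (v (n + 1) - v n) (v (n + 1) - v n))
    (fun n _ => hpos _) (Finset.self_mem_range_succ m)
  simpa [autocorr, hm] using h

end Positivity

section Scheme

variable {H : Type*} [NormedAddCommGroup H] [InnerProductSpace ℝ H]

/-- The shifted sequence `3uⁿ − 2uⁿ⁻¹`. -/
def shifted (u : ℕ → H) (n : ℕ) : H := (3 : ℝ) • u n - (2 : ℝ) • u (n - 1)

/-- The undivided difference `∑ᵢ αᵢ uⁿ⁻⁷⁺ⁱ`. -/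
noncomputable def weightedDiff (u : ℕ → H) (n : ℕ) : H :=
  ∑ i : Fin 8, alphaCoeff i • u (n - 7 + i.1)

theorem energyCoeff_conv_shifted (u : ℕ → H) {n : ℕ} (hn : 13 ≤ n) :
    ∑ j, energyCoeff j • shifted u (n - j)
      = (420 : ℝ) • ∑ j, dissipCoeff j • weightedDiff u (n - j) := by
  obtain ⟨m, rfl⟩ := Nat.exists_eq_add_of_le' hn
  simp [Fin.sum_univ_succ, energyCoeff, dissipCoeff, alphaCoeff, shifted, weightedDiff]
  module

theorem weightedDiff_eq (u : ℕ → H) {n : ℕ} (hn : 7 ≤ n) :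
    weightedDiff u n
      = (3147 / 420 : ℝ) • u n + ∑ i : Fin 7, alphaCoeff i.castSucc • u (n - 7 + i) := by
  rw [weightedDiff, Fin.sum_univ_castSucc, add_comm]
  simp [alphaCoeff, Fin.last, Nat.sub_add_cancel hn]

variable {A : H → H} {B : LinearMap.BilinForm ℝ H} {τ : ℝ}

theorem inner_self_form (x : H) : innerₗ H x x = ‖x‖ ^ 2 := by
  rw [innerₗ_apply_apply, real_inner_self_eq_norm_sq]

theorem innerₗ_symm (x y : H) : innerₗ H x y = innerₗ H y x := by
  simp [real_inner_comm]

theorem innerₗ_self_nonneg (x : H) : 0 ≤ innerₗ H x x := by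
  rw [inner_self_form]
  positivity

theorem form_step_le (hsymm : ∀ x y, B x y = B y x) (hpos : ∀ x, 0 ≤ B x x)
    (hB : ∀ x y, B x y = ⟪A x, y⟫) (hτ : 0 < τ) {x p l w g : H}
    (hw : τ • w = (3147 / 420 : ℝ) • x + l) (hstep : w + A ((3 : ℝ) • x - (2 : ℝ) • p) = g) :
    B x x + τ * ‖w‖ ^ 2 ≤ 17 * B p p + 5 * B l l + τ * ‖g‖ ^ 2 := by
  have h : τ * ‖w‖ ^ 2 + B ((3 : ℝ) • x - (2 : ℝ) • p) (τ • w) = τ * ⟪g, w⟫ := by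
    rw [hB, ← hstep, inner_add_left, real_inner_smul_right, real_inner_self_eq_norm_sq]
    ring
  rw [hw] at h
  simp only [map_sub, map_add, map_smul, LinearMap.sub_apply, LinearMap.smul_apply,
    smul_eq_mul] at h
  have hg := two_mul_form_le innerₗ_symm innerₗ_self_nonneg g w
  rw [inner_self_form, inner_self_form, innerₗ_apply_apply] at hg
  have hg := mul_le_mul_of_nonneg_left hg hτ.le
  have h₁ := two_mul_form_le hsymm hpos p x
  have h₂ := two_mul_form_le hsymm hpos p l
  have h₃ := hpos (x + l)
  simp only [map_add, LinearMap.add_apply, hsymm l x] at h₃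
  have := hpos x
  have := hpos p
  have := hpos l
  have : 0 ≤ τ * ‖w‖ ^ 2 := by positivity
  have : 0 ≤ τ * ‖g‖ ^ 2 := by positivity
  linarith

theorem startup_le (hsymm : ∀ x y, B x y = B y x) (hpos : ∀ x, 0 ≤ B x x)
    (hB : ∀ x y, B x y = ⟪A x, y⟫) (hτ : 0 < τ) {f u : ℕ → H} {m : ℕ}
    (hscheme : ∀ n, 7 ≤ n → n ≤ m → (1 / τ) • weightedDiff u n + A (shifted u n) = shifted f n)
    {D : ℝ} (hu : ∀ j < 7, B (u j) (u j) ≤ D)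
    (hf : ∀ n, 7 ≤ n → n ≤ m → τ * ‖shifted f n‖ ^ 2 ≤ 26 * D) (n : ℕ) (hn : n ≤ m) :
    B (u n) (u n) ≤ 200000 ^ n * D ∧
      (7 ≤ n → τ * ‖(1 / τ) • weightedDiff u n‖ ^ 2 ≤ 200000 ^ n * D) := by
  have hD : 0 ≤ D := (hpos _).trans (hu 0 (by norm_num))
  induction n using Nat.strong_induction_on with
  | _ n ih =>
    by_cases h7 : n < 7
    · refine ⟨(hu n h7).trans ?_, fun h => absurd h (by lia)⟩
      exact le_mul_of_one_le_left hD (one_le_pow₀ (by norm_num))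
    push Not at h7
    obtain ⟨k, rfl⟩ : ∃ k, n = k + 1 := ⟨n - 1, by lia⟩
    have hprev : ∀ j < k + 1, B (u j) (u j) ≤ 200000 ^ k * D := fun j hj =>
      (ih j hj (by lia)).1.trans <| mul_le_mul_of_nonneg_right
        (pow_le_pow_right₀ (by norm_num) (by lia)) hD
    have hstep := form_step_le hsymm hpos hB hτ (x := u (k + 1)) (p := u k)
      (by rw [smul_smul, mul_one_div_cancel hτ.ne', one_smul, weightedDiff_eq u h7])
      (hscheme (k + 1) h7 hn)
    have hl := form_sum_smul_le hsymm hpos (fun i : Fin 7 => alphaCoeff i.castSucc)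
      (fun i => u (k + 1 - 7 + i))
    have hsum : ∑ i : Fin 7, B (u (k + 1 - 7 + i)) (u (k + 1 - 7 + i))
        ≤ 7 * (200000 ^ k * D) := by
      refine (Finset.sum_le_sum fun i _ => hprev _ (by lia)).trans_eq ?_
      simp
    have hα : ∑ i : Fin 7, alphaCoeff i.castSucc ^ 2 ≤ 4667 := by
      simp [Fin.sum_univ_succ, alphaCoeff]
      norm_num
    have hl := hl.trans (mul_le_mul hα hsum (Finset.sum_nonneg fun i _ => hpos _) (by norm_num))
    have hp := hprev k (by lia)
    have hfk := hf (k + 1) h7 hn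
    have hDk : D ≤ 200000 ^ k * D := le_mul_of_one_le_left hD (one_le_pow₀ (by norm_num))
    have := hpos (u (k + 1))
    have : 0 ≤ τ * ‖(1 / τ) • weightedDiff u (k + 1)‖ ^ 2 := by positivity
    rw [pow_succ]
    exact ⟨by linarith, fun _ => by linarith⟩

theorem energyCoeff_conv_le (hsymm : ∀ x y, B x y = B y x) (hpos : ∀ x, 0 ≤ B x x)
    {v : ℕ → H} {D : ℝ} {n : ℕ} (hv : ∀ j ≤ n, B (v j) (v j) ≤ D) :
    B (v n) (∑ j, energyCoeff j • v (n - j)) ≤ 10 ^ 13 * D := by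
  have hD : 0 ≤ D := (hpos _).trans (hv n le_rfl)
  have h₁ := two_mul_form_le hsymm hpos (v n) (∑ j, energyCoeff j • v (n - j))
  have h₂ := form_sum_smul_le hsymm hpos energyCoeff (fun j => v (n - j))
  have h₃ : ∑ j : Fin 13, B (v (n - j)) (v (n - j)) ≤ 13 * D := by
    refine (Finset.sum_le_sum fun j _ => hv _ (Nat.sub_le _ _)).trans_eq ?_
    simp
  have h₄ : ∑ j, energyCoeff j ^ 2 ≤ 10 ^ 12 := by
    simp [Fin.sum_univ_succ, energyCoeff]
    norm_num
  have h₅ := h₂.trans (mul_le_mul h₄ h₃ (Finset.sum_nonneg fun i _ => hpos _) (by norm_num))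
  have := hv n le_rfl
  linarith

theorem norm_dissipCoeff_conv_sq_le (ω : ℕ → H) (n : ℕ) :
    ‖∑ j, dissipCoeff j • ω (n - j)‖ ^ 2 ≤ 86282 * ∑ j : Fin 7, ‖ω (n - j)‖ ^ 2 := by
  have h := form_sum_smul_le innerₗ_symm innerₗ_self_nonneg dissipCoeff (fun j => ω (n - j))
  simp only [inner_self_form] at h
  refine h.trans_eq ?_
  congr 1
  simp [Fin.sum_univ_succ, dissipCoeff]
  norm_num

theorem two_mul_inner_le {c : ℝ} (hc : 0 < c) (x y : H) :
    2 * ⟪x, y⟫ ≤ c * ‖x‖ ^ 2 + c⁻¹ * ‖y‖ ^ 2 := by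
  have h := mul_nonneg (inv_nonneg.2 hc.le) (sq_nonneg ‖c • x - y‖)
  rw [norm_sub_sq_real, norm_smul, real_inner_smul_left, Real.norm_of_nonneg hc.le] at h
  have : c⁻¹ * ((c * ‖x‖) ^ 2 - 2 * (c * ⟪x, y⟫) + ‖y‖ ^ 2)
      = c * ‖x‖ ^ 2 - 2 * ⟪x, y⟫ + c⁻¹ * ‖y‖ ^ 2 := by
    field_simp
  linarith

theorem dissipCoeff_conv_le (hτ : 0 < τ) {ω : ℕ → H} {D : ℝ} {n : ℕ}
    (hω : ∀ j ≤ n, τ * ‖ω j‖ ^ 2 ≤ D) :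
    420 * τ * ⟪ω n, ∑ j, dissipCoeff j • ω (n - j)⟫ ≤ 10 ^ 9 * D := by
  have hD : 0 ≤ D := (by positivity : 0 ≤ τ * ‖ω n‖ ^ 2).trans (hω n le_rfl)
  have h₁ := two_mul_inner_le one_pos (ω n) (∑ j, dissipCoeff j • ω (n - j))
  have h₂ := norm_dissipCoeff_conv_sq_le ω n
  have h₃ : τ * ∑ j : Fin 7, ‖ω (n - j)‖ ^ 2 ≤ 7 * D := by
    rw [Finset.mul_sum]
    refine (Finset.sum_le_sum fun j _ => hω _ (Nat.sub_le _ _)).trans_eq ?_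
    simp
  have h₄ := mul_le_mul_of_nonneg_left h₁ hτ.le
  have h₅ := mul_le_mul_of_nonneg_left h₂ hτ.le
  have := hω n le_rfl
  linarith

theorem energy_le (hsymm : ∀ x y, B x y = B y x) (hpos : ∀ x, 0 ≤ B x x)
    (hB : ∀ x y, B x y = ⟪A x, y⟫) (hτ : 0 < τ) {y w g : ℕ → H} {m : ℕ} (hm : 12 ≤ m)
    (hscheme : ∀ n, 24 ≤ n → n ≤ m → w n + A (y n) = g n)
    (hconv : ∀ n, 24 ≤ n → n ≤ m →
      ∑ j, energyCoeff j • y (n - j) = (420 * τ) • ∑ j, dissipCoeff j • w (n - j))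
    {D F : ℝ} (hD : 0 ≤ D)
    (hy : ∀ n, 12 ≤ n → n < 24 → n ≤ m → B (y n) (y n) ≤ D)
    (hw : ∀ n, 12 ≤ n → n < 24 → n ≤ m → τ * ‖w n‖ ^ 2 ≤ D)
    (hg : τ * ∑ n ∈ Finset.Icc 24 m, ‖g n‖ ^ 2 ≤ F) :
    B (y m) (y m) + τ * ‖w m‖ ^ 2 ≤ 10 ^ 15 * D + 10 ^ 9 * F := by
  set v : ℕ → H := fun n => if 12 ≤ n ∧ n ≤ m then y n else 0 with hv
  set ω : ℕ → H := fun n => if 12 ≤ n ∧ n ≤ m then w n else 0 with hω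
  have hvin : ∀ n, 12 ≤ n → n ≤ m → v n = y n := fun n h₁ h₂ => if_pos ⟨h₁, h₂⟩
  have hωin : ∀ n, 12 ≤ n → n ≤ m → ω n = w n := fun n h₁ h₂ => if_pos ⟨h₁, h₂⟩
  have hvlow : ∀ n < 12, v n = 0 := fun n hn => if_neg (by lia)
  have hωlow : ∀ n < 12, ω n = 0 := fun n hn => if_neg (by lia)
  have hvhigh : ∀ n, m + 1 ≤ n → v n = 0 := fun n hn => if_neg (by lia)
  have hωhigh : ∀ n, m + 1 ≤ n → ω n = 0 := fun n hn => if_neg (by lia)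
  have hvD : ∀ n < 24, B (v n) (v n) ≤ D := fun n hn => by
    by_cases h : 12 ≤ n ∧ n ≤ m
    · rw [hvin n h.1 h.2]
      exact hy n h.1 hn h.2
    · simpa [hv, h] using hD
  have hωD : ∀ n < 24, τ * ‖ω n‖ ^ 2 ≤ D := fun n hn => by
    by_cases h : 12 ≤ n ∧ n ≤ m
    · rw [hωin n h.1 h.2]
      exact hw n h.1 hn h.2
    · simpa [hω, h] using hD
  have hterm : ∀ n ∈ Finset.range (m + 1), B (v n) (∑ j, energyCoeff j • v (n - j))
      + 420 * τ * ⟪ω n, ∑ j, dissipCoeff j • ω (n - j)⟫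
      ≤ (if n < 24 then 10 ^ 13 * D + 10 ^ 9 * D else 0)
        + 420000000 * (τ * if 24 ≤ n then ‖g n‖ ^ 2 else 0)
        + 10 * (τ * ∑ j : Fin 7, ‖ω (n - j)‖ ^ 2) := fun n hn => by
    have hn := Finset.mem_range.1 hn
    have hnonneg : 0 ≤ τ * ∑ j : Fin 7, ‖ω (n - j)‖ ^ 2 := by positivity
    by_cases h24 : n < 24
    · have h₁ := energyCoeff_conv_le hsymm hpos (v := v) (n := n) fun j hj => hvD j (by lia)
      have h₂ := dissipCoeff_conv_le hτ (ω := ω) (n := n) fun j hj => hωD j (by lia)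
      rw [if_pos h24, if_neg (by lia)]
      linarith
    · have hvc : ∑ j, energyCoeff j • v (n - j) = (420 * τ) • ∑ j, dissipCoeff j • ω (n - j) := by
        rw [Finset.sum_congr rfl fun j _ => by rw [hvin (n - j) (by lia) (by lia)],
          hconv n (by lia) (by lia)]
        exact congrArg _ (Finset.sum_congr rfl fun j _ => by rw [hωin (n - j) (by lia) (by lia)])
      have hz := norm_dissipCoeff_conv_sq_le ω n
      rw [if_neg h24, if_pos (by lia), hvc, map_smul, smul_eq_mul, hB,
        hvin n (by lia) (by lia), hωin n (by lia) (by lia), ← mul_add, ← inner_add_left,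
        add_comm (A _), hscheme n (by lia) (by lia)]
      have h₁ := mul_le_mul_of_nonneg_left (two_mul_inner_le (c := 2000000) (by norm_num) (g n)
        (∑ j, dissipCoeff j • ω (n - j))) hτ.le
      have h₂ := mul_le_mul_of_nonneg_left hz hτ.le
      linarith
  have hsum := Finset.sum_le_sum hterm
  rw [Finset.sum_add_distrib, Finset.sum_add_distrib, Finset.sum_add_distrib, ← Finset.mul_sum,
    ← Finset.mul_sum, ← Finset.mul_sum, ← Finset.mul_sum, ← Finset.mul_sum] at hsum
  have hstart : ∑ n ∈ Finset.range (m + 1), (if n < 24 then 10 ^ 13 * D + 10 ^ 9 * D else 0)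
      ≤ 24 * (10 ^ 13 * D + 10 ^ 9 * D) := by
    rw [← Finset.sum_filter, Finset.sum_const, nsmul_eq_mul]
    refine mul_le_mul_of_nonneg_right ?_ (by positivity)
    have : (Finset.range (m + 1)).filter (· < 24) ⊆ Finset.range 24 := fun n hn => by
      simpa using (Finset.mem_filter.1 hn).2
    exact_mod_cast (Finset.card_le_card this).trans_eq (Finset.card_range 24)
  have hsource : ∑ n ∈ Finset.range (m + 1), (if 24 ≤ n then ‖g n‖ ^ 2 else 0)
      = ∑ n ∈ Finset.Icc 24 m, ‖g n‖ ^ 2 := by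
    rw [← Finset.sum_filter]
    refine Finset.sum_congr (Finset.ext fun n => ?_) fun _ _ => rfl
    simp only [Finset.mem_filter, Finset.mem_range, Finset.mem_Icc]
    lia
  have hlag : ∑ n ∈ Finset.range (m + 1), ∑ j : Fin 7, ‖ω (n - j)‖ ^ 2
      ≤ 7 * ∑ n ∈ Finset.range (m + 1), ‖ω n‖ ^ 2 := by
    rw [Finset.sum_comm]
    refine (Finset.sum_le_sum fun j _ => sum_range_sub_le (g := fun n => ‖ω n‖ ^ 2) (a := 12)
      (fun n => by positivity) (fun n hn => by simp [hωlow n hn]) (by lia) _).trans_eq ?_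
    simp
  have hE := (form_le_autocorr_diff hpos (hvhigh (m + 1) le_rfl)).trans
    (energyCoeff_form_ge hsymm hpos hvlow hvhigh)
  have hdis := dissipCoeff_form_ge innerₗ_symm innerₗ_self_nonneg hωlow hωhigh
  simp only [autocorr, add_zero, inner_self_form, innerₗ_apply_apply] at hdis
  have hlast : ‖ω m‖ ^ 2 ≤ ∑ n ∈ Finset.range (m + 1), ‖ω n‖ ^ 2 :=
    Finset.single_le_sum (f := fun n => ‖ω n‖ ^ 2) (fun n _ => by positivity)
      (Finset.self_mem_range_succ m)
  rw [hvin m hm le_rfl] at hE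
  rw [hωin m hm le_rfl] at hlast
  rw [hsource] at hsum
  have h₁ := mul_le_mul_of_nonneg_left hdis hτ.le
  have h₂ := mul_le_mul_of_nonneg_left hlast hτ.le
  have h₃ := mul_le_mul_of_nonneg_left hlag hτ.le
  have h₄ : 0 ≤ τ * ‖w m‖ ^ 2 := by positivity
  have h₅ : 0 ≤ τ * ∑ n ∈ Finset.Icc 24 m, ‖g n‖ ^ 2 := by positivity
  linarith

theorem stability_le (hsymm : ∀ x y, B x y = B y x) (hpos : ∀ x, 0 ≤ B x x)
    (hB : ∀ x y, B x y = ⟪A x, y⟫) (hτ : 0 < τ) {f u : ℕ → H} {m : ℕ}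
    (hscheme : ∀ n, 7 ≤ n → n ≤ m → (1 / τ) • weightedDiff u n + A (shifted u n) = shifted f n)
    {D : ℝ} (hu : ∀ j < 7, B (u j) (u j) ≤ D)
    (hf : τ * ∑ n ∈ Finset.Icc 7 m, ‖shifted f n‖ ^ 2 ≤ 26 * D) (hm : 7 ≤ m) :
    B (u m) (u m) + τ * ‖(1 / τ) • weightedDiff u m‖ ^ 2 ≤ 2 * (10 ^ 17 * 200000 ^ 24 * D) := by
  have hD : 0 ≤ D := (hpos _).trans (hu 0 (by norm_num))
  have hfn : ∀ n, 7 ≤ n → n ≤ m → τ * ‖shifted f n‖ ^ 2 ≤ 26 * D := fun n h₁ h₂ =>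
    (mul_le_mul_of_nonneg_left (Finset.single_le_sum (f := fun n => ‖shifted f n‖ ^ 2)
      (fun n _ => by positivity) (Finset.mem_Icc.2 ⟨h₁, h₂⟩)) hτ.le).trans hf
  have hstart : ∀ n, n < 24 → n ≤ m → B (u n) (u n) ≤ 200000 ^ 24 * D ∧
      (7 ≤ n → τ * ‖(1 / τ) • weightedDiff u n‖ ^ 2 ≤ 200000 ^ 24 * D) := fun n h₁ h₂ => by
    have hmono : 200000 ^ n * D ≤ 200000 ^ 24 * D :=
      mul_le_mul_of_nonneg_right (pow_le_pow_right₀ (by norm_num) h₁.le) hD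
    have h := startup_le hsymm hpos hB hτ hscheme hu hfn n h₂
    exact ⟨h.1.trans hmono, fun h₇ => (h.2 h₇).trans hmono⟩
  have henergy : ∀ n, 24 ≤ n → n ≤ m → B (shifted u n) (shifted u n)
      + τ * ‖(1 / τ) • weightedDiff u n‖ ^ 2 ≤ 10 ^ 17 * 200000 ^ 24 * D := fun n h₁ h₂ => by
    have h := energy_le hsymm hpos hB hτ (y := shifted u)
      (w := fun n => (1 / τ) • weightedDiff u n) (g := shifted f) (m := n)
      (D := 26 * (200000 ^ 24 * D)) (F := 26 * D) (by lia)
      (fun k _ _ => hscheme k (by lia) (by lia))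
      (fun k _ _ => by
        rw [energyCoeff_conv_shifted u (by lia)]
        simp only [Finset.smul_sum, smul_smul]
        refine Finset.sum_congr rfl fun j _ => ?_
        congr 1
        field_simp)
      (by positivity)
      (fun k _ _ _ => by
        have := form_shifted_le hsymm hpos (u k) (u (k - 1))
        have := (hstart k (by lia) (by lia)).1
        have := (hstart (k - 1) (by lia) (by lia)).1
        rw [shifted]
        linarith)
      (fun k _ _ _ => by
        have := (hstart k (by lia) (by lia)).2 (by lia)
        have : 0 ≤ 200000 ^ 24 * D := by positivity
        linarith)
      ((mul_le_mul_of_nonneg_left (Finset.sum_le_sum_of_subset_of_nonneg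
        (Finset.Icc_subset_Icc (by lia) h₂) fun _ _ _ => by positivity) hτ.le).trans hf)
    linarith
  have hbound : ∀ n ≤ m, B (u n) (u n) ≤ 10 ^ 17 * 200000 ^ 24 * D := fun n => by
    induction n with
    | zero => exact fun _ => by linarith [hu 0 (by norm_num)]
    | succ n ih =>
      intro hn
      by_cases h24 : n + 1 < 24
      · linarith [(hstart (n + 1) h24 hn).1]
      · have h₁ := form_le_of_shifted hsymm hpos (u (n + 1)) (u n)
        have h₂ := henergy (n + 1) (by lia) hn
        have : 0 ≤ τ * ‖(1 / τ) • weightedDiff u (n + 1)‖ ^ 2 := by positivity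
        rw [shifted, Nat.add_sub_cancel] at h₂
        linarith [ih (by lia)]
  have hdiff : τ * ‖(1 / τ) • weightedDiff u m‖ ^ 2 ≤ 10 ^ 17 * 200000 ^ 24 * D := by
    by_cases h24 : m < 24
    · linarith [(hstart m h24 le_rfl).2 hm]
    · linarith [henergy m (by lia) le_rfl, hpos (shifted u m)]
  linarith [hbound m le_rfl]

theorem sum_norm_shifted_sq_le (f : ℕ → H) (m : ℕ) :
    ∑ n ∈ Finset.Icc 7 m, ‖shifted f n‖ ^ 2 ≤ 26 * ∑ n ∈ Finset.Icc 6 m, ‖f n‖ ^ 2 := by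
  have h₁ : ∑ n ∈ Finset.Icc 7 m, ‖shifted f n‖ ^ 2
      ≤ ∑ n ∈ Finset.Icc 7 m, (18 * ‖f n‖ ^ 2 + 8 * ‖f (n - 1)‖ ^ 2) :=
    Finset.sum_le_sum fun n _ => by
      have h := form_shifted_le innerₗ_symm innerₗ_self_nonneg (f n) (f (n - 1))
      simp only [inner_self_form] at h
      exact h
  have h₂ : ∑ n ∈ Finset.Icc 7 m, ‖f n‖ ^ 2 ≤ ∑ n ∈ Finset.Icc 6 m, ‖f n‖ ^ 2 :=
    Finset.sum_le_sum_of_subset_of_nonneg (Finset.Icc_subset_Icc (by lia) le_rfl)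
      fun _ _ _ => by positivity
  have h₃ : ∑ n ∈ Finset.Icc 7 m, ‖f (n - 1)‖ ^ 2 ≤ ∑ n ∈ Finset.Icc 6 m, ‖f n‖ ^ 2 := by
    rw [← Finset.sum_image (f := fun n => ‖f n‖ ^ 2) (g := fun n => n - 1)
      fun x hx y hy h => by
        have hx := Finset.mem_Icc.1 hx
        have hy := Finset.mem_Icc.1 hy
        dsimp only at h
        lia]
    refine Finset.sum_le_sum_of_subset_of_nonneg (Finset.image_subset_iff.2 fun n hn => ?_)
      fun _ _ _ => by positivity
    rw [Finset.mem_Icc] at hn ⊢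
    lia
  rw [Finset.sum_add_distrib, ← Finset.mul_sum, ← Finset.mul_sum] at h₁
  linarith

end Scheme

/-- Second stability estimate for the WSBDF7 method with weight θ = 3:
`‖uⁿ‖² + τ|u̇ⁿ|² ≤ C Σ_{j=0}^{6} ‖u^j‖² + C τ Σ_{ℓ=6}^{n} |f^ℓ|²`,
where `u̇^m = (1/τ) Σ_{i=0}^{7} α_i u^{m−7+i}` and `‖v‖² = (Av,v)`. -/
theorem wsbdf7_second_stability :
    ∃ C : ℝ, 0 < C ∧
      ∀ (H : Type) [_i1 : NormedAddCommGroup H] [_i2 : InnerProductSpace ℝ H]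
        [_i3 : CompleteSpace H]
        (A B : H →L[ℝ] H),
        (∀ v w : H, ⟪A v, w⟫ = ⟪v, A w⟫) →
        (∃ lam : ℝ, 0 < lam ∧ ∀ v : H, lam * ‖v‖ ^ 2 ≤ ⟪A v, v⟫) →
        (∀ v : H, A (B v) = v) → (∀ v : H, B (A v) = v) →
        ∀ τ : ℝ, 0 < τ → ∀ N : ℕ, 7 ≤ N →
        ∀ f u : ℕ → H,
          (∀ n : ℕ, n ≤ N - 7 →
            ∑ i : Fin 8, alphaCoeff i • u (n + i.1) + (3 * τ) • A (u (n + 7))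
              - (2 * τ) • A (u (n + 6))
            = (3 * τ) • f (n + 7) - (2 * τ) • f (n + 6)) →
          ∀ n : ℕ, 7 ≤ n → n ≤ N →
            ⟪A (u n), u n⟫
              + τ * ‖(1 / τ) • ∑ i : Fin 8, alphaCoeff i • u (n - 7 + i.1)‖ ^ 2
              ≤ C * ∑ j ∈ Finset.range 7, ⟪A (u j), u j⟫
                + C * τ * ∑ ℓ ∈ Finset.Icc 6 n, ‖f ℓ‖ ^ 2 := by
  refine ⟨2 * (10 ^ 17 * 200000 ^ 24), by positivity, ?_⟩
  intro H _ _ _ A _ hA hcoer _ _ τ hτ N hN f u hu n hn hnN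
  obtain ⟨lam, hlam, hcoer⟩ := hcoer
  let B : LinearMap.BilinForm ℝ H := (innerₗ H).comp (A : H →ₗ[ℝ] H)
  have hB : ∀ x y, B x y = ⟪A x, y⟫ := fun _ _ => rfl
  have hsymm : ∀ x y, B x y = B y x := fun x y => by rw [hB, hB, hA, real_inner_comm]
  have hpos : ∀ x, 0 ≤ B x x := fun x => le_trans (by positivity) (hcoer x)
  have hscheme : ∀ k, 7 ≤ k → k ≤ n →
      (1 / τ) • weightedDiff u k + A (shifted u k) = shifted f k := fun k h₁ h₂ => by
    have h := congrArg ((1 / τ) • ·) (hu (k - 7) (by lia))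
    simp only [show k - 7 + 7 = k by lia, show k - 7 + 6 = k - 1 by lia, smul_sub, smul_add,
      smul_smul, ← mul_assoc, mul_right_comm (1 / τ) _ τ, one_div_mul_cancel hτ.ne',
      one_mul] at h
    rw [shifted, shifted, map_sub, map_smul, map_smul, ← h, weightedDiff, ← add_sub_assoc]
  set S := ∑ j ∈ Finset.range 7, ⟪A (u j), u j⟫
  set F := ∑ ℓ ∈ Finset.Icc 6 n, ‖f ℓ‖ ^ 2
  have hF : 0 ≤ τ * F := by positivity
  have hS : ∀ j < 7, B (u j) (u j) ≤ S := fun j hj =>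
    Finset.single_le_sum (f := fun j => ⟪A (u j), u j⟫) (fun j _ => hpos (u j))
      (Finset.mem_range.2 hj)
  have hS₀ : 0 ≤ S := (hpos _).trans (hS 0 (by norm_num))
  have h := stability_le hsymm hpos hB hτ hscheme (D := S + τ * F)
    (fun j hj => (hS j hj).trans (by linarith))
    (by linarith [mul_le_mul_of_nonneg_left (sum_norm_shifted_sq_le f n) hτ.le]) hn
  rw [hB, weightedDiff] at h
  linarith
end

section
/- The polynomial P(x) = 32000x⁶ − 124640x⁵ + 173872x⁴ − 104870x³ + 24891x² − 1105x + 62 is strictly positive for every x in the interval [−1, 1]. -/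
/-- The Bernstein basis products of degree six on `[a, b]` are nonnegative there. -/
theorem bernstein_six_nonneg {a b x : ℝ} (ha : a ≤ x) (hb : x ≤ b) (i : ℕ) :
    0 ≤ (x - a) ^ i * (b - x) ^ (6 - i) :=
  mul_nonneg (pow_nonneg (sub_nonneg.2 ha) _) (pow_nonneg (sub_nonneg.2 hb) _)

/-- The polynomial
`P(x) = 32000x⁶ − 124640x⁵ + 173872x⁴ − 104870x³ + 24891x² − 1105x + 62`
is strictly positive on `[−1, 1]`. -/
theorem P_pos_on_Icc :
    ∀ x ∈ Set.Icc (-1 : ℝ) 1,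
      0 < 32000 * x ^ 6 - 124640 * x ^ 5 + 173872 * x ^ 4 - 104870 * x ^ 3
            + 24891 * x ^ 2 - 1105 * x + 62 := by
  rintro x ⟨-, hx⟩
  have of_mem_quarter {a b : ℝ} (ha : a ≤ x) (hb : x ≤ b)
      (hab : a = 0 ∧ b = 1 / 4 ∨ a = 1 / 4 ∧ b = 1 / 2 ∨ a = 1 / 2 ∧ b = 3 / 4 ∨
        a = 3 / 4 ∧ b = 1) :
      0 < 32000 * x ^ 6 - 124640 * x ^ 5 + 173872 * x ^ 4 - 104870 * x ^ 3
            + 24891 * x ^ 2 - 1105 * x + 62 := by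
    have h := bernstein_six_nonneg ha hb
    have h0 := h 0
    have h1 := h 1
    have h2 := h 2
    have h3 := h 3
    have h4 := h 4
    have h5 := h 5
    have h6 := h 6
    rcases hab with ⟨rfl, rfl⟩ | ⟨rfl, rfl⟩ | ⟨rfl, rfl⟩ | ⟨rfl, rfl⟩ <;>
      norm_num only at h0 h1 h2 h3 h4 h5 h6 <;> linarith
  rcases le_total x 0 with hx0 | hx0
  · obtain ⟨y, rfl⟩ : ∃ y, x = -y := ⟨-x, (neg_neg x).symm⟩
    have hy : 0 ≤ y := neg_nonpos.1 hx0
    have : 0 < 32000 * y ^ 6 + 124640 * y ^ 5 + 173872 * y ^ 4 + 104870 * y ^ 3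
        + 24891 * y ^ 2 + 1105 * y + 62 := by positivity
    linarith
  rcases le_total x (1 / 4) with h | h
  · exact of_mem_quarter hx0 h (by norm_num)
  rcases le_total x (1 / 2) with h' | h'
  · exact of_mem_quarter h h' (by norm_num)
  rcases le_total x (3 / 4) with h'' | h''
  · exact of_mem_quarter h' h'' (by norm_num)
  · exact of_mem_quarter h'' hx (by norm_num)
end

section
/- The polynomial g(x) = 7.2x⁴ − 15.6x³ + 6.8x² + 1.7x + 0.1 satisfies g(x) ≥ 0.01 for every x in the interval [−1, 1]. -/
/-- The polynomial `g(x) = 7.2x⁴ − 15.6x³ + 6.8x² + 1.7x + 0.1` satisfies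
`g(x) ≥ 0.01` on `[−1, 1]`. -/
theorem g_ge_on_Icc :
    ∀ x ∈ Set.Icc (-1 : ℝ) 1,
      (0.01 : ℝ) ≤ 7.2 * x ^ 4 - 15.6 * x ^ 3 + 6.8 * x ^ 2 + 1.7 * x + 0.1 := by
  rintro x ⟨-, hx1⟩
  rcases le_total x 0 with hx | hx
  · have hcubic : 0 ≤ -x * (x + 0.093) ^ 2 := mul_nonneg (neg_nonneg.2 hx) (sq_nonneg _)
    have hquartic : 0 ≤ x ^ 4 := by positivity
    have hsq : 0 ≤ (x + 0.0946) ^ 2 := sq_nonneg _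
    nlinarith only [hcubic, hquartic, hsq]
  · have hq : 0 ≤ 1.6 + 1.2 * x + 7.2 * (x * (1 - x)) := by
      have := mul_nonneg hx (sub_nonneg.2 hx1)
      positivity
    have hfactor := mul_nonneg (mul_nonneg hx (sub_nonneg.2 hx1)) hq
    linear_combination hfactor + 0.1 * hx
end

section
/- Let μ₁, μ₂, μ₃, μ₄ be real numbers and define, for x ∈ ℝ, P(x) := 3200x⁶ − 9904x⁵ + 8184x⁴ + 2990x³ − 7020x² + 2584x − 454 + μ₁(−1600x⁵ + 4952x⁴ − 4492x³ − 257x² + 2287x − 260) + μ₂(−800x⁴ + 2476x³ − 2446x² + 2064x − 454) + μ₃(−400x³ + 4385x² − 3195x + 260) + μ₄(6294x³ − 3944x² − 1544x + 454), and g(x) := −2x + 3 + μ₁(−3x + 2) + μ₂(−6x² + 2x + 3) + μ₃(−12x³ + 4x² + 9x − 2) + μ₄(−24x⁴ + 8x³ + 24x² − 6x − 3). If P(x) ≥ 0 and g(x) > 0 for all x ∈ [−1, 1], then 1.5561 ≤ μ₁ < 2.3133, −2.2024 < μ₂ < −1.4259, 0.5394 < μ₃ < 1.3955, and −0.6518 <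 μ₄ < −0.0504. (Range of multipliers of the form (μ₁, μ₂, μ₃, μ₄, 0, 0, 0) for the WSBDF7 method with θ = 3.) -/
/-- Range of multipliers of the form `(μ₁, μ₂, μ₃, μ₄, 0, 0, 0)` for the
WSBDF7 method with weight θ = 3: if `P(x) ≥ 0` and `g(x) > 0` on `[−1, 1]`,
then `1.5561 ≤ μ₁ < 2.3133`, `−2.2024 < μ₂ < −1.4259`, `0.5394 < μ₃ < 1.3955`,
and `−0.6518 < μ₄ < −0.0504`. -/
theorem range_of_multipliers (μ₁ μ₂ μ₃ μ₄ : ℝ)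
    (hP : ∀ x ∈ Set.Icc (-1 : ℝ) 1,
      0 ≤ 3200 * x ^ 6 - 9904 * x ^ 5 + 8184 * x ^ 4 + 2990 * x ^ 3 - 7020 * x ^ 2
            + 2584 * x - 454
          + μ₁ * (-1600 * x ^ 5 + 4952 * x ^ 4 - 4492 * x ^ 3 - 257 * x ^ 2
              + 2287 * x - 260)
          + μ₂ * (-800 * x ^ 4 + 2476 * x ^ 3 - 2446 * x ^ 2 + 2064 * x - 454)
          + μ₃ * (-400 * x ^ 3 + 4385 * x ^ 2 - 3195 * x + 260)
          + μ₄ * (6294 * x ^ 3 - 3944 * x ^ 2 - 1544 * x + 454))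
    (hg : ∀ x ∈ Set.Icc (-1 : ℝ) 1,
      0 < -2 * x + 3 + μ₁ * (-3 * x + 2) + μ₂ * (-6 * x ^ 2 + 2 * x + 3)
          + μ₃ * (-12 * x ^ 3 + 4 * x ^ 2 + 9 * x - 2)
          + μ₄ * (-24 * x ^ 4 + 8 * x ^ 3 + 24 * x ^ 2 - 6 * x - 3)) :
    (1.5561 ≤ μ₁ ∧ μ₁ < 2.3133) ∧ (-2.2024 < μ₂ ∧ μ₂ < -1.4259) ∧
    (0.5394 < μ₃ ∧ μ₃ < 1.3955) ∧ (-0.6518 < μ₄ ∧ μ₄ < -0.0504) := by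
  refine ⟨⟨?_, ?_⟩, ⟨?_, ?_⟩, ⟨?_, ?_⟩, ⟨?_, ?_⟩⟩
  · have h₁ := hP 0 (by norm_num)
    have h₂ := hP 1 (by norm_num)
    have h₃ := hg (-1/8) (by norm_num)
    have h₄ := hP (5/8) (by norm_num)
    linarith
  · have h₁ := hg (1/6) (by norm_num)
    have h₂ := hP (-1/15) (by norm_num)
    have h₃ := hg (29/30) (by norm_num)
    have h₄ := hg (14/15) (by norm_num)
    linarith
  · have h₁ := hg (4/5) (by norm_num)
    have h₂ := hg 0 (by norm_num)
    have h₃ := hg 1 (by norm_num)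
    have h₄ := hP 1 (by norm_num)
    linarith
  · have h₁ := hP (3/4) (by norm_num)
    have h₂ := hg 1 (by norm_num)
    have h₃ := hP 0 (by norm_num)
    have h₄ := hP (1/2) (by norm_num)
    linarith
  · have h₁ := hP (-1/4) (by norm_num)
    have h₂ := hP 0 (by norm_num)
    have h₃ := hP (3/4) (by norm_num)
    have h₄ := hg (1/4) (by norm_num)
    linarith
  · have h₁ := hP 0 (by norm_num)
    have h₂ := hg (-1/5) (by norm_num)
    have h₃ := hg 1 (by norm_num)
    have h₄ := hP 1 (by norm_num)
    linarith
  · have h₁ := hP 1 (by norm_num)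
    have h₂ := hg 1 (by norm_num)
    have h₃ := hP 0 (by norm_num)
    have h₄ := hg (-1/4) (by norm_num)
    linarith
  · have h₁ := hg (1/8) (by norm_num)
    have h₂ := hP (-1/8) (by norm_num)
    have h₃ := hP (5/8) (by norm_num)
    have h₄ := hg 1 (by norm_num)
    linarith
end

section
/- There do not exist real numbers μ₁, μ₂, μ₃ such that, with μ₄ = 0, the polynomials P(x) := 3200x⁶ − 9904x⁵ + 8184x⁴ + 2990x³ − 7020x² + 2584x − 454 + μ₁(−1600x⁵ + 4952x⁴ − 4492x³ − 257x² + 2287x − 260) + μ₂(−800x⁴ + 2476x³ − 2446x² + 2064x − 454) + μ₃(−400x³ + 4385x² − 3195x + 260) and g(x) := −2x + 3 + μ₁(−3x + 2) + μ₂(−6x² + 2x + 3) + μ₃(−12x³ + 4x² + 9x − 2) satisfy P(x) ≥ 0 and g(x) > 0 for all x ∈ [−1, 1]. (Nonexistence of multipliers of the form (μ₁, μ₂, μ₃, 0, 0, 0, 0) for the WSBDF7 method with θ = 3.) -/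
/-- Nonexistence of multipliers of the form `(μ₁, μ₂, μ₃, 0, 0, 0, 0)` for the
WSBDF7 method with weight θ = 3. -/
theorem no_three_term_multipliers :
    ¬∃ μ₁ μ₂ μ₃ : ℝ,
      (∀ x ∈ Set.Icc (-1 : ℝ) 1,
        0 ≤ 3200 * x ^ 6 - 9904 * x ^ 5 + 8184 * x ^ 4 + 2990 * x ^ 3
              - 7020 * x ^ 2 + 2584 * x - 454
            + μ₁ * (-1600 * x ^ 5 + 4952 * x ^ 4 - 4492 * x ^ 3 - 257 * x ^ 2
                + 2287 * x - 260)
            + μ₂ * (-800 * x ^ 4 + 2476 * x ^ 3 - 2446 * x ^ 2 + 2064 * x - 454)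
            + μ₃ * (-400 * x ^ 3 + 4385 * x ^ 2 - 3195 * x + 260)) ∧
      (∀ x ∈ Set.Icc (-1 : ℝ) 1,
        0 < -2 * x + 3 + μ₁ * (-3 * x + 2) + μ₂ * (-6 * x ^ 2 + 2 * x + 3)
            + μ₃ * (-12 * x ^ 3 + 4 * x ^ 2 + 9 * x - 2)) := by
  rintro ⟨μ₁, μ₂, μ₃, hP, hg⟩
  have hP₁ := hP (5 / 8) (by norm_num)
  have hP₂ := hP (-1 / 8) (by norm_num)
  have hg₁ := hg 1 (by norm_num)
  have hg₂ := hg (1 / 8) (by norm_num)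
  linarith
end

section
/- The characteristic polynomial ã(ζ) = (1/420)(60ζ⁷ + 609ζ⁶ − 1260ζ⁵ + 1050ζ⁴ − 700ζ³ + 315ζ² − 84ζ + 10) of the shifted seven-step BDF method satisfies ã(−13)·ã(−12) < 0; consequently ã has a real root in the open interval (−13, −12), and in particular the shifted seven-step BDF method is not zero-stable (ã has a root of modulus greater than 1). -/
/-- The characteristic polynomial
`ã(ζ) = (1/420)(60ζ⁷ + 609ζ⁶ − 1260ζ⁵ + 1050ζ⁴ − 700ζ³ + 315ζ² − 84ζ + 10)`
of the shifted seven-step BDF method satisfies `ã(−13)·ã(−12) < 0`, hence has a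
real root in `(−13, −12)`; in particular it has a root of modulus greater
than 1, so the shifted seven-step BDF method is not zero-stable. -/
theorem sbdf7_not_zero_stable :
    ((1 / 420 : ℝ) * (60 * (-13 : ℝ) ^ 7 + 609 * (-13 : ℝ) ^ 6 - 1260 * (-13 : ℝ) ^ 5
        + 1050 * (-13 : ℝ) ^ 4 - 700 * (-13 : ℝ) ^ 3 + 315 * (-13 : ℝ) ^ 2
        - 84 * (-13 : ℝ) + 10)
      * ((1 / 420 : ℝ) * (60 * (-12 : ℝ) ^ 7 + 609 * (-12 : ℝ) ^ 6
          - 1260 * (-12 : ℝ) ^ 5 + 1050 * (-12 : ℝ) ^ 4 - 700 * (-12 : ℝ) ^ 3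
          + 315 * (-12 : ℝ) ^ 2 - 84 * (-12 : ℝ) + 10)) < 0) ∧
    (∃ x ∈ Set.Ioo (-13 : ℝ) (-12),
      (1 / 420 : ℝ) * (60 * x ^ 7 + 609 * x ^ 6 - 1260 * x ^ 5 + 1050 * x ^ 4
          - 700 * x ^ 3 + 315 * x ^ 2 - 84 * x + 10) = 0) ∧
    (∃ x : ℝ,
      (1 / 420 : ℝ) * (60 * x ^ 7 + 609 * x ^ 6 - 1260 * x ^ 5 + 1050 * x ^ 4
          - 700 * x ^ 3 + 315 * x ^ 2 - 84 * x + 10) = 0 ∧ 1 < |x|) := by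
  have root : ∃ x ∈ Set.Ioo (-13 : ℝ) (-12),
      (1 / 420 : ℝ) * (60 * x ^ 7 + 609 * x ^ 6 - 1260 * x ^ 5 + 1050 * x ^ 4
          - 700 * x ^ 3 + 315 * x ^ 2 - 84 * x + 10) = 0 :=
    intermediate_value_Ioo (by norm_num) (by fun_prop) ⟨by norm_num, by norm_num⟩
  refine ⟨by norm_num, root, ?_⟩
  obtain ⟨x, hx, hroot⟩ := root
  exact ⟨x, hroot, lt_abs.mpr (Or.inr (by linarith [hx.2]))⟩
end

section
/- There exists a constant C > 0 with the following property: for every real Hilbert space H (with norm |·|), every eight times continuously differentiable function u : ℝ → H, every τ > 0 and every t ∈ ℝ, one has |Σ_{i=0}^{7} α_i u(t + iτ) − 3τ u′(t + 7τ) + 2τ u′(t + 6τ)| ≤ C τ⁸ · sup_{s ∈ [t, t+7τ]} |u⁽⁸⁾(s)|, where α₀,…,α₇ are the coefficients of α(ζ) = (1/420)(3147ζ⁷ − 10038ζ⁶ + 15750ζ⁵ − 16800ζ⁴ + 12425ζ³ − 5922ζ² + 1638ζ − 200). (The WSBDF7 method with θ = 3 has consistency order 7.) -/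
/-- Taylor's theorem for a globally smooth function, with the two-sided iterated derivatives at
the base point and a remainder bound coming from a bound on the next derivative. -/
theorem norm_sub_sum_iteratedDeriv_le {E : Type*} [NormedAddCommGroup E] [NormedSpace ℝ E]
    {f : ℝ → E} {n : ℕ} (hf : ContDiff ℝ (n + 1 : ℕ) f) {t L M : ℝ} (hL : 0 < L)
    (hM : ∀ s ∈ Set.Icc t (t + L), ‖iteratedDeriv (n + 1) f s‖ ≤ M)
    {h : ℝ} (h0 : 0 ≤ h) (hhL : h ≤ L) :
    ‖f (t + h) - ∑ k ∈ Finset.range (n + 1),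
        ((k.factorial : ℝ)⁻¹ * h ^ k) • iteratedDeriv k f t‖ ≤ M * L ^ (n + 1) / n.factorial := by
  have ht : t ∈ Set.Icc t (t + L) := ⟨le_rfl, by linarith⟩
  have huniq : UniqueDiffOn ℝ (Set.Icc t (t + L)) := uniqueDiffOn_Icc (by linarith)
  have hM0 : 0 ≤ M := (norm_nonneg _).trans (hM t ht)
  have key := taylor_mean_remainder_bound (f := f) (n := n) (C := M) (x := t + h)
    (by linarith : t ≤ t + L) (by exact_mod_cast hf.contDiffOn) ⟨by linarith, by linarith⟩
    (fun y hy => by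
      rw [iteratedDerivWithin_eq_iteratedDeriv huniq hf.contDiffAt hy]
      exact hM y hy)
  rw [taylor_within_apply] at key
  have hsum : ∑ k ∈ Finset.range (n + 1), ((k.factorial : ℝ)⁻¹ * (t + h - t) ^ k) •
        iteratedDerivWithin k f (Set.Icc t (t + L)) t
      = ∑ k ∈ Finset.range (n + 1), ((k.factorial : ℝ)⁻¹ * h ^ k) • iteratedDeriv k f t := by
    refine Finset.sum_congr rfl fun k hk => ?_
    have hkn : k ≤ n + 1 := (Finset.mem_range.1 hk).le
    rw [iteratedDerivWithin_eq_iteratedDeriv huniq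
      (hf.of_le (by exact_mod_cast hkn)).contDiffAt ht, add_sub_cancel_left]
  rw [hsum, add_sub_cancel_left] at key
  refine key.trans ?_
  gcongr

/-- The order conditions: the scheme annihilates Taylor polynomials of degree seven, so the values
`v`, `d₆`, `d₇` may be replaced by their Taylor remainders with respect to any jet `w`. -/
theorem wsbdf7_eq_remainder {E : Type*} [AddCommGroup E] [Module ℝ E] (v : Fin 8 → E)
    (d₆ d₇ : E) (w : ℕ → E) (τ : ℝ) :
    ∑ i : Fin 8, alphaCoeff i • v i - (3 * τ) • d₇ + (2 * τ) • d₆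
      = ∑ i : Fin 8, alphaCoeff i • (v i - ∑ k ∈ Finset.range 8,
            ((k.factorial : ℝ)⁻¹ * ((i : ℕ) * τ) ^ k) • w k)
        - (3 * τ) • (d₇ - ∑ k ∈ Finset.range 7,
            ((k.factorial : ℝ)⁻¹ * (7 * τ) ^ k) • w (k + 1))
        + (2 * τ) • (d₆ - ∑ k ∈ Finset.range 7,
            ((k.factorial : ℝ)⁻¹ * (6 * τ) ^ k) • w (k + 1)) := by
  simp only [Fin.sum_univ_eight, Finset.sum_range_succ, Finset.sum_range_zero, alphaCoeff,
    Nat.factorial]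
  simp
  module

/-- Consistency of order 7 of the WSBDF7 method with weight θ = 3:
`|Σ_{i=0}^{7} α_i u(t + iτ) − 3τ u′(t + 7τ) + 2τ u′(t + 6τ)|
  ≤ C τ⁸ sup_{s ∈ [t, t+7τ]} |u⁽⁸⁾(s)|`. -/
theorem wsbdf7_consistency_order_seven :
    ∃ C : ℝ, 0 < C ∧
      ∀ (H : Type) [_i1 : NormedAddCommGroup H] [_i2 : InnerProductSpace ℝ H]
        [_i3 : CompleteSpace H],
        ∀ u : ℝ → H, ContDiff ℝ 8 u →
        ∀ τ : ℝ, 0 < τ → ∀ t : ℝ,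
          ‖∑ i : Fin 8, alphaCoeff i • u (t + (i : ℕ) * τ)
              - (3 * τ) • deriv u (t + 7 * τ) + (2 * τ) • deriv u (t + 6 * τ)‖
            ≤ C * τ ^ 8 *
              sSup ((fun s => ‖iteratedDeriv 8 u s‖) '' Set.Icc t (t + 7 * τ)) := by
  refine ⟨(∑ i : Fin 8, |alphaCoeff i|) * (7 ^ 8 / (7).factorial) + 5 * (7 ^ 7 / (6).factorial),
    by positivity, ?_⟩
  intro H _ _ _ u hu τ hτ t
  set M := sSup ((fun s => ‖iteratedDeriv 8 u s‖) '' Set.Icc t (t + 7 * τ))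
  have hM : ∀ s ∈ Set.Icc t (t + 7 * τ), ‖iteratedDeriv 8 u s‖ ≤ M := fun s hs =>
    le_csSup (isCompact_Icc.image
      (hu.continuous_iteratedDeriv 8 le_rfl).norm).bddAbove (Set.mem_image_of_mem _ hs)
  have hL : 0 < 7 * τ := by positivity
  have hderiv : ContDiff ℝ (6 + 1 : ℕ) (deriv u) :=
    ContDiff.deriv' (n := 7) (by norm_num; exact hu)
  have hR (i : Fin 8) := norm_sub_sum_iteratedDeriv_le (n := 7) (h := (i : ℕ) * τ)
    (by exact_mod_cast hu) hL hM (by positivity) (by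
      have : ((i : ℕ) : ℝ) ≤ 7 := by exact_mod_cast Nat.le_of_lt_succ i.isLt
      gcongr)
  have hR' {h : ℝ} := norm_sub_sum_iteratedDeriv_le (n := 6) (h := h) hderiv hL
    (by simpa only [← iteratedDeriv_succ'] using hM)
  simp only [← iteratedDeriv_succ'] at hR'
  have h₇ := hR' hL.le le_rfl
  have h₆ := hR' (h := 6 * τ) (by positivity) (by linarith)
  rw [wsbdf7_eq_remainder (fun i : Fin 8 => u (t + (i : ℕ) * τ)) _ _
    (fun k => iteratedDeriv k u t)]
  calc _ ≤ (∑ i : Fin 8, |alphaCoeff i| * (M * (7 * τ) ^ (7 + 1) / (7).factorial))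
        + (3 * τ) * (M * (7 * τ) ^ (6 + 1) / (6).factorial)
        + (2 * τ) * (M * (7 * τ) ^ (6 + 1) / (6).factorial) := by
        refine (norm_add_le _ _).trans (add_le_add ((norm_sub_le _ _).trans (add_le_add
          ((norm_sum_le _ _).trans (Finset.sum_le_sum fun i _ => ?_)) ?_)) ?_)
        · rw [norm_smul, Real.norm_eq_abs]
          gcongr
          exact hR i
        · rw [norm_smul, Real.norm_of_nonneg (by positivity)]
          gcongr
        · rw [norm_smul, Real.norm_of_nonneg (by positivity)]
          gcongr
    _ = _ := by
        rw [← Finset.sum_mul]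
        ring
end

section
/- There exists a symmetric positive definite matrix G = (g_{ij}) ∈ ℝ^{7×7} such that for every real inner product space (with inner product (·,·)) and all elements u⁰, u¹, …, u⁷ of the space, (Σ_{i=0}^{7} α_i u^i, u⁷ − 1.6u⁶ + 1.6u⁵ − 1.1u⁴ + 0.3u³) ≥ Σ_{i,j=1}^{7} g_{ij}(u^i, u^j) − Σ_{i,j=1}^{7} g_{ij}(u^{i−1}, u^{j−1}), where α₀,…,α₇ are the coefficients of α(ζ) = (1/420)(3147ζ⁷ − 10038ζ⁶ + 15750ζ⁵ − 16800ζ⁴ + 12425ζ³ − 5922ζ² + 1638ζ − 200). -/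
open scoped RealInnerProductSpace

open Matrix

/-- A matrix that certifies the G-stability of the WSBDF7 method with weight `θ = 3`. -/
noncomputable def wsbdf7GMatrix : Matrix (Fin 7) (Fin 7) ℝ :=
  (1 / 3360000 : ℝ) • !![3625633, -11804629, 20669176, -24881437, 21096453, -12475320, 3930124;
    -11804629, 42283844, -79664711, 101174501, -89811689, 55756328, -19084044;
    20669176, -79664711, 161537730, -217483899, 201876620, -131229044, 47881328;
    -24881437, 101174501, -217483899, 307845295, -296704196, 199849980, -76153044;
    21096453, -89811689, 201876620, -296704196, 294750908, -204199476, 80078580;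
    -12475320, 55756328, -131229044, 199849980, -204199476, 145916248, -59131516;
    3930124, -19084044, 47881328, -76153044, 80078580, -59131516, 24996172]

theorem wsbdf7GMatrix_isSymm : wsbdf7GMatrix.IsSymm := by
  refine Matrix.IsSymm.smul ?_ _
  ext i j
  fin_cases i <;> fin_cases j <;> rfl

/-- The smallest eigenvalue of `wsbdf7GMatrix` is at least `1 / 3360`. -/
theorem wsbdf7GMatrix_dotProduct_mulVec_ge (x : Fin 7 → ℝ) :
    (1 / 3360 : ℝ) * ∑ i, x i ^ 2 ≤ x ⬝ᵥ wsbdf7GMatrix *ᵥ x := by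
  simp only [wsbdf7GMatrix, Matrix.smul_apply, smul_eq_mul, dotProduct, mulVec,
    Fin.sum_univ_seven, of_apply, cons_val]
  have h0 := mul_nonneg (show (0 : ℝ) ≤ 1 / 3624633 by norm_num)
    (sq_nonneg (3624633 * x 0 - 11804629 * x 1 + 20669176 * x 2 - 24881437 * x 3 + 21096453 * x 4 -
        12475320 * x 5 + 3930124 * x 6))
  have h1 := mul_nonneg (show (0 : ℝ) ≤ 1 / 50420551110721094763 by norm_num)
    (sq_nonneg (13910525868611 * x 1 - 44763386010359 * x 2 + 73004302311260 * x 3 -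
        76498610854200 * x 4 + 54829702171344 * x 5 - 22778999911856 * x 6))
  have h2 := mul_nonneg (show (0 : ℝ) ≤ 1 / 760751348911547991179315911816991 by norm_num)
    (sq_nonneg (54688899334005614581 * x 2 - 150042700233379518405 * x 3 +
        190022066600798084244 * x 4 - 158742892251339777132 * x 5 + 72987261087178337312 * x 6))
  have h3 := mul_nonneg (show (0 : ℝ) ≤ 1 / 5229038202693506762284735021697450174374984647
      by norm_num)
    (sq_nonneg (95614252003094992994618187 * x 3 - 199387663932704848316297979 * x 4 +
        192259078775590001824327360 * x 5 - 98298568625827656632337368 * x 6))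
  have h4 := mul_nonneg (show (0 : ℝ) ≤
      4 / 210967510230271579310407445289324779675028786183620418169 by norm_num)
    (sq_nonneg (6619332551702940164763863947361 * x 4 - 11306452758312925588691612755723 * x 5 +
        5293931912671320058615256200312 * x 6))
  have h5 := mul_nonneg (show (0 : ℝ) ≤
      4 / 72571562463557495432222411198640163191808727006577563972440680184743 by norm_num)
    (sq_nonneg (3654525684007580679759496551979247021 * x 5 -
        4243416833689191215920980750913643821 * x 6))
  have h6 := mul_nonneg (show (0 : ℝ) ≤
      250342665036956692905113648516938303339000 / 3654525684007580679759496551979247021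
      by norm_num)
    (sq_nonneg (x 6))
  linarith

theorem wsbdf7GMatrix_posDef : wsbdf7GMatrix.PosDef := by
  refine .of_dotProduct_mulVec_pos ?_ fun x hx => ?_
  · rw [IsHermitian, conjTranspose_eq_transpose_of_trivial, wsbdf7GMatrix_isSymm.eq]
  obtain ⟨i, hi⟩ := Function.ne_iff.mp hx
  have hsum : 0 < ∑ i, x i ^ 2 :=
    Finset.sum_pos' (fun _ _ => sq_nonneg _) ⟨i, Finset.mem_univ i, sq_pos_of_ne_zero hi⟩
  have := wsbdf7GMatrix_dotProduct_mulVec_ge x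
  rw [star_trivial]
  linarith

/-- G-stability inequality for the WSBDF7 method (θ = 3) and its multiplier
`(1.6, −1.6, 1.1, −0.3, 0, 0, 0)`: there is a symmetric positive definite
`G ∈ ℝ^{7×7}` with
`(Σ_i α_i u^i, u⁷ − 1.6u⁶ + 1.6u⁵ − 1.1u⁴ + 0.3u³)
  ≥ Σ_{i,j=1}^{7} g_{ij}(u^i,u^j) − Σ_{i,j=1}^{7} g_{ij}(u^{i−1},u^{j−1})`
in every real inner product space. -/
theorem wsbdf7_G_stability :
    ∃ G : Matrix (Fin 7) (Fin 7) ℝ, G.IsSymm ∧ G.PosDef ∧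
      ∀ (E : Type) [_i1 : NormedAddCommGroup E] [_i2 : InnerProductSpace ℝ E],
        ∀ u : Fin 8 → E,
          ⟪∑ i : Fin 8, alphaCoeff i • u i,
              u 7 - (1.6 : ℝ) • u 6 + (1.6 : ℝ) • u 5 - (1.1 : ℝ) • u 4
                + (0.3 : ℝ) • u 3⟫
            ≥ (∑ i : Fin 7, ∑ j : Fin 7, G i j * ⟪u i.succ, u j.succ⟫)
              - (∑ i : Fin 7, ∑ j : Fin 7, G i j * ⟪u i.castSucc, u j.castSucc⟫) := by
  refine ⟨wsbdf7GMatrix, wsbdf7GMatrix_isSymm, wsbdf7GMatrix_posDef, fun E _ _ u => ?_⟩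
  have hδ := real_inner_self_nonneg (x := (413 : ℝ) • (u 1 - u 0) + (-943 : ℝ) • (u 2 - u 1) +
      (1440 : ℝ) • (u 3 - u 2) + (-1456 : ℝ) • (u 4 - u 3) + (1077 : ℝ) • (u 5 - u 4) +
      (-508 : ℝ) • (u 6 - u 5) + (92 : ℝ) • (u 7 - u 6))
  have h0 := real_inner_self_nonneg (x := u 1 - u 0)
  have h1 := real_inner_self_nonneg (x := u 1 - u 0 - (u 2 - u 1))
  have h2 := real_inner_self_nonneg (x := u 1 - u 0 + (u 3 - u 2))
  have h3 := real_inner_self_nonneg (x := u 1 - u 0 - (u 4 - u 3))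
  have h4 := real_inner_self_nonneg (x := u 1 - u 0 + (u 5 - u 4))
  have h5 := real_inner_self_nonneg (x := u 1 - u 0 - (u 6 - u 5))
  have h6 := real_inner_self_nonneg (x := u 1 - u 0 + (u 7 - u 6))
  have hcomm (i j : Fin 8) : ⟪u i, u j⟫ = ⟪u j, u i⟫ := real_inner_comm _ _
  simp only [wsbdf7GMatrix, Matrix.smul_apply, Fin.sum_univ_seven, Fin.sum_univ_eight,
    Matrix.of_apply, Matrix.cons_val, alphaCoeff, smul_eq_mul, inner_add_left, inner_add_right,
    inner_sub_left, inner_sub_right, real_inner_smul_left, real_inner_smul_right,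
    Fin.reduceSucc, Fin.reduceCastSucc] at *
  simp only [hcomm 1 0, hcomm 2 0, hcomm 2 1, hcomm 3 0, hcomm 3 1, hcomm 3 2, hcomm 4 0,
      hcomm 4 1, hcomm 4 2, hcomm 4 3, hcomm 5 0, hcomm 5 1, hcomm 5 2, hcomm 5 3, hcomm 5 4,
      hcomm 6 0, hcomm 6 1, hcomm 6 2, hcomm 6 3, hcomm 6 4, hcomm 6 5, hcomm 7 0, hcomm 7 1,
      hcomm 7 2, hcomm 7 3, hcomm 7 4, hcomm 7 5, hcomm 7 6] at *
  linarith only [hδ, h0, h1, h2, h3, h4, h5, h6]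
end

section
/- There exist a constant c⋆ > 0 and a symmetric positive definite matrix G̃ = (g̃_{ij}) ∈ ℝ^{4×4} such that for every real inner product space (with inner product (·,·)) and all elements v⁰, v¹, v², v³, v⁴ of the space, (3v⁴ − 2v³ − c⋆(v⁴ − 1.6v³ + 1.6v² − 1.1v¹ + 0.3v⁰), v⁴ − 1.6v³ + 1.6v² − 1.1v¹ + 0.3v⁰) ≥ Σ_{i,j=1}^{4} g̃_{ij}(v^i, v^j) − Σ_{i,j=1}^{4} g̃_{ij}(v^{i−1}, v^{j−1}). -/
open scoped RealInnerProductSpace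

/-- The matrix `G̃` of the G-stability inequality for the pair `(δ - κ / 500, κ)`. -/
noncomputable def wsbdf7G : Matrix (Fin 4) (Fin 4) ℝ :=
  (1 / 120 : ℝ) • !![80, -112, 110, -81;
    -112, 281, -300, 178;
    110, -300, 462, -296;
    -81, 178, -296, 280]

theorem wsbdf7G_isSymm : wsbdf7G.IsSymm := by
  ext i j
  fin_cases i <;> fin_cases j <;> simp [wsbdf7G]

theorem wsbdf7G_posDef : wsbdf7G.PosDef := by
  refine Matrix.PosDef.of_dotProduct_mulVec_pos ?_ fun x hx => ?_
  · rw [Matrix.IsHermitian, Matrix.conjTranspose_eq_transpose_of_trivial]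
    exact wsbdf7G_isSymm
  · have key : star x ⬝ᵥ wsbdf7G.mulVec x = 1 / 120 *
        ((80 * x 0 - 112 * x 1 + 110 * x 2 - 81 * x 3) ^ 2 / 80
          + (621 * x 1 - 730 * x 2 + 323 * x 3) ^ 2 / 3105
          + (691166 * x 2 - 539953 * x 3) ^ 2 / 3433712688
          + 54933393 / 691166 * x 3 ^ 2) := by
      simp [wsbdf7G, Matrix.mulVec, dotProduct, Fin.sum_univ_four]
      ring
    rw [key]
    by_contra! h
    have h3 : x 3 = 0 := pow_eq_zero_iff two_ne_zero |>.mp <| le_antisymm (by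
      nlinarith [sq_nonneg (80 * x 0 - 112 * x 1 + 110 * x 2 - 81 * x 3),
        sq_nonneg (621 * x 1 - 730 * x 2 + 323 * x 3),
        sq_nonneg (691166 * x 2 - 539953 * x 3)]) (sq_nonneg _)
    rw [h3] at h
    have h2 : x 2 = 0 := pow_eq_zero_iff two_ne_zero |>.mp <| le_antisymm (by
      nlinarith [sq_nonneg (80 * x 0 - 112 * x 1 + 110 * x 2 - 81 * 0),
        sq_nonneg (621 * x 1 - 730 * x 2 + 323 * 0)]) (sq_nonneg _)
    rw [h2] at h
    have h1 : x 1 = 0 := pow_eq_zero_iff two_ne_zero |>.mp <| le_antisymm (by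
      nlinarith [sq_nonneg (80 * x 0 - 112 * x 1 + 110 * 0 - 81 * 0)]) (sq_nonneg _)
    rw [h1] at h
    have h0 : x 0 = 0 := pow_eq_zero_iff two_ne_zero |>.mp <| le_antisymm (by
      nlinarith) (sq_nonneg _)
    refine hx (funext fun i => ?_)
    fin_cases i <;> assumption

/-- G-stability inequality for the pair `(δ − c⋆κ, κ)` with `δ(ζ) = 3ζ⁴ − 2ζ³`
and `κ(ζ) = ζ⁴ − 1.6ζ³ + 1.6ζ² − 1.1ζ + 0.3`: there are `c⋆ > 0` and a
symmetric positive definite `G̃ ∈ ℝ^{4×4}` such that in every real inner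
product space, for all `v⁰,…,v⁴`,
`(3v⁴ − 2v³ − c⋆(v⁴ − 1.6v³ + 1.6v² − 1.1v¹ + 0.3v⁰),
  v⁴ − 1.6v³ + 1.6v² − 1.1v¹ + 0.3v⁰)
  ≥ Σ_{i,j=1}^{4} g̃_{ij}(v^i,v^j) − Σ_{i,j=1}^{4} g̃_{ij}(v^{i−1},v^{j−1})`. -/
theorem wsbdf7_delta_kappa_G_stability :
    ∃ cstar : ℝ, 0 < cstar ∧
      ∃ G : Matrix (Fin 4) (Fin 4) ℝ, G.IsSymm ∧ G.PosDef ∧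
        ∀ (E : Type) [_i1 : NormedAddCommGroup E] [_i2 : InnerProductSpace ℝ E],
          ∀ v : Fin 5 → E,
            ⟪(3 : ℝ) • v 4 - (2 : ℝ) • v 3
                - cstar • (v 4 - (1.6 : ℝ) • v 3 + (1.6 : ℝ) • v 2
                    - (1.1 : ℝ) • v 1 + (0.3 : ℝ) • v 0),
              v 4 - (1.6 : ℝ) • v 3 + (1.6 : ℝ) • v 2 - (1.1 : ℝ) • v 1
                + (0.3 : ℝ) • v 0⟫
              ≥ (∑ i : Fin 4, ∑ j : Fin 4, G i j * ⟪v i.succ, v j.succ⟫)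
                - (∑ i : Fin 4, ∑ j : Fin 4, G i j * ⟪v i.castSucc, v j.castSucc⟫) := by
  refine ⟨1 / 500, by norm_num, wsbdf7G, wsbdf7G_isSymm, wsbdf7G_posDef, fun E _ _ v => ?_⟩
  have h0 := real_inner_self_nonneg
    (x := (99973 : ℝ) • v 0 - (139901 : ℝ) • v 1 + (137356 : ℝ) • v 2
      - (146106 : ℝ) • v 3 + (67410 : ℝ) • v 4)
  have h1 := real_inner_self_nonneg
    (x := (4407709 : ℝ) • v 1 - (3379702 : ℝ) • v 2
      + (3600071 : ℝ) • v 3 - (4125867 : ℝ) • v 4)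
  have h2 := real_inner_self_nonneg
    (x := (904853 : ℝ) • v 2 + (212034 : ℝ) • v 3 + (1005520 : ℝ) • v 4)
  have h3 := real_inner_self_nonneg (x := (14767335 : ℝ) • v 3 - (55813 : ℝ) • v 4)
  have h4 := real_inner_self_nonneg (x := v 4)
  simp only [inner_add_left, inner_add_right, inner_sub_left, inner_sub_right,
    real_inner_smul_left, real_inner_smul_right] at h0 h1 h2 h3 h4 ⊢
  simp only [Fin.sum_univ_four, wsbdf7G, Matrix.smul_apply, smul_eq_mul, Matrix.of_apply,
    Matrix.cons_val, Fin.reduceSucc, Fin.reduceCastSucc,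
    real_inner_comm (v 0) (v 1), real_inner_comm (v 0) (v 2), real_inner_comm (v 0) (v 3),
    real_inner_comm (v 0) (v 4), real_inner_comm (v 1) (v 2), real_inner_comm (v 1) (v 3),
    real_inner_comm (v 1) (v 4), real_inner_comm (v 2) (v 3), real_inner_comm (v 2) (v 4),
    real_inner_comm (v 3) (v 4)] at h0 h1 h2 h3 h4 ⊢
  linear_combination (1 / 14995950000) * h0 + (1 / 52878227022840) * h1
    + (1 / 28152908553720) * h2 + (1 / 27259025448580200) * h3 + (1686359 / 443020050) * h4
end
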